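/- arXiv:1702.07837 — 12 statements merged into one kernel-verified Lean document; each statement's English description precedes it below -/
import Mathlib

section
/- There exist ℚ_p-subspaces S and T of M ⊗_{ℤ_p} ℚ_p such that M ⊗_{ℤ_p} ℚ_p is the internal direct sum S ⊕ T, both S and T are stable under the endomorphisms F ⊗ 1 and V ⊗ 1, every root in a fixed algebraic closure of ℚ_p of the characteristic polynomial of the restriction of F ⊗ 1 to S has p-adic valuation exactly 1, and every root of the characteristic polynomial of the restriction of F ⊗ 1 to T has p-adic valuation strictly less than 1. -/
open Polynomial
open scoped TensorProduct

set_option synthInstance.maxHeartbeats 4000000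
set_option maxHeartbeats 4000000

/-- A nonzero polynomial factors into a part whose roots in an extension all satisfy a predicate
that is constant on conjugacy classes, and a part none of whose roots does. -/
theorem Polynomial.exists_eq_mul_of_roots_predicate {k K : Type*} [Field k] [Field K] [Algebra k K]
    (P : K → Prop) (hP : ∀ a b : K, minpoly k a = minpoly k b → P a → P b)
    (f : k[X]) (hf : f ≠ 0) :
    ∃ g h : k[X], f = g * h ∧ (∀ a : K, aeval a g = 0 → P a) ∧
      (∀ a : K, aeval a h = 0 → ¬ P a) := by
  induction f using UniqueFactorizationMonoid.induction_on_prime with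
  | h₁ => exact absurd rfl hf
  | h₂ u hu =>
    refine ⟨1, u, (one_mul u).symm, by simp, fun a ha => ?_⟩
    exact absurd ha (hu.map (aeval a)).ne_zero
  | h₃ f q hf0 hq ih =>
    obtain ⟨g, h, rfl, hg, hh⟩ := ih hf0
    have hconj (a b : K) (ha : aeval a q = 0) (hb : aeval b q = 0) :
        minpoly k a = minpoly k b := by
      rw [← minpoly.eq_of_irreducible hq.irreducible ha,
        ← minpoly.eq_of_irreducible hq.irreducible hb]
    by_cases hex : ∃ a : K, aeval a q = 0 ∧ P a
    · obtain ⟨a, ha, hPa⟩ := hex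
      refine ⟨q * g, h, (mul_assoc _ _ _).symm, fun b hb => ?_, hh⟩
      rw [map_mul, mul_eq_zero] at hb
      exact hb.elim (fun hb => hP a b (hconj a b ha hb) hPa) (hg b)
    · refine ⟨g, q * h, mul_left_comm _ _ _, hg, fun b hb hPb => ?_⟩
      rw [map_mul, mul_eq_zero] at hb
      exact hb.elim (fun hb => hex ⟨b, hb, hPb⟩) (fun hb => hh b hb hPb)

theorem LinearMap.aeval_baseChange_eq {k K E : Type*} [CommRing k] [CommRing K] [Algebra k K]
    [AddCommGroup E] [Module k E] (f : E →ₗ[k] E) (g : k[X]) :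
    aeval (f.baseChange K) (g.map (algebraMap k K)) = (aeval f g).baseChange K := by
  rw [aeval_map_algebraMap]
  exact aeval_algHom_apply (Module.End.baseChangeHom k K E) f g

/-- Roots of the characteristic polynomial of `f` in an extension of the base field are roots of
every polynomial annihilating `f`. -/
theorem LinearMap.aeval_eq_zero_of_charpoly {k K E : Type*} [Field k] [Field K] [Algebra k K]
    [AddCommGroup E] [Module k E] [Module.Finite k E] {f : E →ₗ[k] E} {g : k[X]}
    (hg : aeval f g = 0) {a : K} (ha : aeval a f.charpoly = 0) : aeval a g = 0 := by
  have hev : Module.End.HasEigenvalue (f.baseChange K) a := by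
    rw [Module.End.hasEigenvalue_iff_isRoot_charpoly, LinearMap.charpoly_baseChange, IsRoot.def,
      eval_map_algebraMap, ha]
  obtain ⟨x, hx⟩ := hev.exists_hasEigenvector
  have h := Module.End.aeval_apply_of_hasEigenvector (p := g.map (algebraMap k K)) hx
  rw [LinearMap.aeval_baseChange_eq, hg, LinearMap.baseChange_zero, LinearMap.zero_apply,
    eval_map_algebraMap] at h
  exact (smul_eq_zero.mp h.symm).resolve_right hx.2

/-- If `v * f` is multiplication by a nonzero scalar `c`, then `c / a` is an eigenvalue of `v` for
every eigenvalue `a` of `f`. -/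
theorem LinearMap.aeval_div_charpoly_eq_zero {k K E : Type*} [Field k] [Field K] [Algebra k K]
    [AddCommGroup E] [Module k E] [Module.Finite k E] {f v : E →ₗ[k] E} {c : k} (hc : c ≠ 0)
    (hvf : v ∘ₗ f = c • LinearMap.id) {a : K} (ha : aeval a f.charpoly = 0) :
    a ≠ 0 ∧ aeval (algebraMap k K c / a) v.charpoly = 0 := by
  have hev : Module.End.HasEigenvalue (f.baseChange K) a := by
    rw [Module.End.hasEigenvalue_iff_isRoot_charpoly, LinearMap.charpoly_baseChange, IsRoot.def,
      eval_map_algebraMap, ha]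
  obtain ⟨x, hx⟩ := hev.exists_hasEigenvector
  have hvfx : a • v.baseChange K x = algebraMap k K c • x := by
    have h := congrArg (fun u => u.baseChange K x) hvf
    simp only [LinearMap.baseChange_comp, LinearMap.baseChange_smul, LinearMap.comp_apply,
      LinearMap.baseChange_id, LinearMap.smul_apply, LinearMap.id_apply, hx.apply_eq_smul,
      map_smul] at h
    rw [h, algebraMap_smul]
  have ha0 : a ≠ 0 := by
    rintro rfl
    rw [zero_smul, eq_comm, smul_eq_zero] at hvfx
    exact hvfx.elim (by simpa using hc) hx.2
  refine ⟨ha0, ?_⟩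
  have hv : Module.End.HasEigenvalue (v.baseChange K) (algebraMap k K c / a) := by
    refine Module.End.hasEigenvalue_of_hasEigenvector (x := x)
      (Module.End.hasEigenvector_iff.mpr ⟨Module.End.mem_eigenspace_iff.mpr ?_, hx.2⟩)
    rw [div_eq_inv_mul, mul_smul, ← hvfx, smul_smul, inv_mul_cancel₀ ha0, one_smul]
  rw [Module.End.hasEigenvalue_iff_isRoot_charpoly, LinearMap.charpoly_baseChange, IsRoot.def,
    eval_map_algebraMap] at hv
  exact hv

theorem LinearMap.coe_aeval_restrict_apply {k E : Type*} [CommRing k]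
    [AddCommGroup E] [Module k E] (f : E →ₗ[k] E) {S : Submodule k E}
    (hf : ∀ x ∈ S, f x ∈ S) (g : k[X]) (x : S) :
    (aeval (f.restrict hf) g x : E) = aeval f g x := by
  induction g using Polynomial.induction_on generalizing x with
  | C a => simp [Module.algebraMap_end_apply]
  | add q r hq hr => simp [hq, hr]
  | monomial n a h =>
    rw [pow_succ, ← mul_assoc, aeval_mul, aeval_mul (p := C a * X ^ n), aeval_X, aeval_X, Module.End.mul_apply,
      Module.End.mul_apply, h, LinearMap.coe_restrict_apply]

theorem LinearMap.aeval_restrict_ker_aeval_eq_zero {k E : Type*} [CommRing k]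
    [AddCommGroup E] [Module k E] (f : E →ₗ[k] E) (g : k[X])
    (hf : ∀ x ∈ LinearMap.ker (aeval f g), f x ∈ LinearMap.ker (aeval f g)) :
    aeval (f.restrict hf) g = 0 :=
  LinearMap.ext fun x => Subtype.ext <|
    (LinearMap.coe_aeval_restrict_apply f hf g x).trans (LinearMap.mem_ker.mp x.2)

theorem Commute.polynomial_aeval_right {k A : Type*} [CommSemiring k] [Semiring A] [Algebra k A]
    {u a : A} (h : Commute u a) (q : k[X]) : Commute u (aeval a q) := by
  induction q using Polynomial.induction_on' with
  | add q r hq hr => rw [map_add]; exact hq.add_right hr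
  | monomial n c =>
    rw [aeval_monomial]
    exact (Algebra.commute_algebraMap_right c u).mul_right (h.pow_right n)

/-- Decomposition of a torsion-free Dieudonné module (after inverting `p`)
into an ordinary part (all eigenvalues of Frobenius of valuation `1`) and a non-ordinary
part (all eigenvalues of Frobenius of valuation `< 1`). -/
theorem dieudonne_ordinary_nonordinary_decomposition
    {p : ℕ} [Fact p.Prime]
    -- `K` is a fixed algebraic closure of `ℚ_p`, with the (unique) extension of the p-adic norm
    {K : Type} [NormedField K] [Algebra ℚ_[p] K] [IsAlgClosure ℚ_[p] K]
    (hnorm : ∀ x : ℚ_[p], ‖algebraMap ℚ_[p] K x‖ = ‖x‖)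
    -- `M` is a finite free `ℤ_p`-module with `F ∘ V = V ∘ F = p • id`
    {M : Type} [AddCommGroup M] [Module ℤ_[p] M]
    [Module.Finite ℤ_[p] M] [Module.Free ℤ_[p] M]
    (F V : M →ₗ[ℤ_[p]] M)
    (hFV : F ∘ₗ V = (p : ℤ_[p]) • LinearMap.id)
    (hVF : V ∘ₗ F = (p : ℤ_[p]) • LinearMap.id) :
    ∃ S T : Submodule ℚ_[p] (ℚ_[p] ⊗[ℤ_[p]] M),
      IsCompl S T ∧
      ∃ (hFS : ∀ x ∈ S, F.baseChange ℚ_[p] x ∈ S) (_ : ∀ x ∈ S, V.baseChange ℚ_[p] x ∈ S)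
        (hFT : ∀ x ∈ T, F.baseChange ℚ_[p] x ∈ T) (_ : ∀ x ∈ T, V.baseChange ℚ_[p] x ∈ T),
        (∀ α : K, Polynomial.aeval α
            (LinearMap.charpoly (R := ℚ_[p]) (M := S) ((F.baseChange ℚ_[p]).restrict hFS)) = 0 →
          ‖α‖ = (p : ℝ)⁻¹) ∧
        (∀ α : K, Polynomial.aeval α
            (LinearMap.charpoly (R := ℚ_[p]) (M := T) ((F.baseChange ℚ_[p]).restrict hFT)) = 0 →
          (p : ℝ)⁻¹ < ‖α‖) := by
  have hnorm_spectral (x : K) : ‖x‖ = spectralNorm ℚ_[p] K x :=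
    spectralNorm_unique_field_norm_ext (f := NormedField.toAbsoluteValue K) hnorm x
  have hp0 : (p : ℚ_[p]) ≠ 0 := Nat.cast_ne_zero.mpr (Fact.out : p.Prime).ne_zero
  have hint (b : K) (hb : aeval b (V.baseChange ℚ_[p]).charpoly = 0) : ‖b‖ ≤ 1 := by
    rw [hnorm_spectral]
    refine (norm_root_le_spectralValue (f := spectralAlgNorm ℚ_[p] K) spectralAlgNorm_isPowMul
      isNonarchimedean_spectralNorm (LinearMap.charpoly_monic _) hb).trans ?_
    rw [spectralValue_le_one_iff (LinearMap.charpoly_monic _), LinearMap.charpoly_baseChange]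
    intro n
    rw [coeff_map]
    exact PadicInt.norm_le_one _
  have hVFQ : V.baseChange ℚ_[p] ∘ₗ F.baseChange ℚ_[p] = (p : ℚ_[p]) • LinearMap.id := by
    rw [← LinearMap.baseChange_comp, hVF, LinearMap.baseChange_smul, LinearMap.baseChange_id]
    ext
    simp [Algebra.smul_def]
  have hFVQ : F.baseChange ℚ_[p] ∘ₗ V.baseChange ℚ_[p] = (p : ℚ_[p]) • LinearMap.id := by
    rw [← hVFQ, ← LinearMap.baseChange_comp, ← LinearMap.baseChange_comp, hFV, hVF]
  have hlower (a : K) (ha : aeval a (F.baseChange ℚ_[p]).charpoly = 0) : (p : ℝ)⁻¹ ≤ ‖a‖ := by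
    obtain ⟨ha0, hpa⟩ := LinearMap.aeval_div_charpoly_eq_zero hp0 hVFQ ha
    have h := hint _ hpa
    rwa [norm_div, hnorm, Padic.norm_p, div_le_one (norm_pos_iff.mpr ha0)] at h
  obtain ⟨g, h, hgh, hg, hh⟩ := Polynomial.exists_eq_mul_of_roots_predicate (k := ℚ_[p])
    (fun a : K => ‖a‖ = (p : ℝ)⁻¹)
    (fun a b hab ha => by
      rw [hnorm_spectral, spectralNorm] at ha ⊢
      rwa [← hab])
    (F.baseChange ℚ_[p]).charpoly (LinearMap.charpoly_monic _).ne_zero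
  have : IsAlgClosed K := IsAlgClosure.isAlgClosed ℚ_[p]
  have hcop : IsCoprime g h :=
    (isCoprime_iff_aeval_ne_zero_of_isAlgClosed _ K g h).mpr fun a =>
      or_iff_not_imp_left.mpr fun hga hha => hh a hha (hg a (not_not.mp hga))
  have hcomm : Commute (V.baseChange ℚ_[p]) (F.baseChange ℚ_[p]) := hVFQ.trans hFVQ.symm
  have hstable (u : Module.End ℚ_[p] (ℚ_[p] ⊗[ℤ_[p]] M)) (hu : Commute u (F.baseChange ℚ_[p]))
      (q : ℚ_[p][X]) (x) (hx : x ∈ LinearMap.ker (aeval (F.baseChange ℚ_[p]) q)) :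
      u x ∈ LinearMap.ker (aeval (F.baseChange ℚ_[p]) q) := by
    rw [LinearMap.mem_ker] at hx ⊢
    rw [← Module.End.mul_apply, ← (hu.polynomial_aeval_right q).eq, Module.End.mul_apply, hx, map_zero]
  refine ⟨LinearMap.ker (aeval (F.baseChange ℚ_[p]) g),
    LinearMap.ker (aeval (F.baseChange ℚ_[p]) h),
    ⟨disjoint_ker_aeval_of_isCoprime _ hcop, codisjoint_iff.mpr ?_⟩,
    hstable _ (Commute.refl _) g, hstable _ hcomm g, hstable _ (Commute.refl _) h,
    hstable _ hcomm h, fun a ha => ?_, fun a ha => ?_⟩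
  · rw [sup_ker_aeval_eq_ker_aeval_mul_of_coprime _ hcop, ← hgh, LinearMap.aeval_self_charpoly,
      LinearMap.ker_zero]
  · exact hg a (LinearMap.aeval_eq_zero_of_charpoly
      (LinearMap.aeval_restrict_ker_aeval_eq_zero _ g _) ha)
  · have hha := LinearMap.aeval_eq_zero_of_charpoly
      (LinearMap.aeval_restrict_ker_aeval_eq_zero _ h _) ha
    refine (hlower a ?_).lt_of_ne' (hh a hha)
    rw [hgh, map_mul, hha, mul_zero]
end

section
/- For every a ∈ 𝕎(k) there exists a unique ε ∈ 𝕎(k) such that Σ_{s=0}^{d} b_s·σ^s(ε) = b_0·a. Moreover, setting ε_n := σ^n(ε) for n ≥ 0, one has Σ_{s=0}^{d} b_s·ε_{n+s} = b_0·σ^n(a) for every n ≥ 0. -/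
/-- On a `p`-adically complete ring, a `p`-divisible perturbation of the identity by an additive
map is bijective. -/
theorem IsAdicComplete.bijective_id_add_natCast_mul {R : Type*} [CommRing R] (p : ℕ)
    [IsAdicComplete (Ideal.span {(p : R)}) R] (h : R →+ R) :
    Function.Bijective (fun x => x + (p : R) * h x) := by
  have map_dvd : ∀ (n : ℕ) (z : R), (p : R) ^ n ∣ z → (p : R) ^ (n + 1) ∣ p * h z := by
    rintro n _ ⟨w, rfl⟩
    have hw : h ((p : R) ^ n * w) = (p : R) ^ n * h w := by
      simpa [nsmul_eq_mul] using map_nsmul h (p ^ n) w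
    exact ⟨h w, by rw [hw]; ring⟩
  have modEq_iff : ∀ (n : ℕ) (x y : R),
      x ≡ y [SMOD (Ideal.span {(p : R)} ^ n • ⊤ : Submodule R R)] ↔ (p : R) ^ n ∣ x - y := by
    intro n x y
    rw [SModEq.sub_mem, smul_eq_mul, Ideal.mul_top, Ideal.span_singleton_pow,
      Ideal.mem_span_singleton]
  have eq_zero : ∀ x : R, (∀ n : ℕ, (p : R) ^ n ∣ x) → x = 0 := fun x hx =>
    IsHausdorff.haus (I := Ideal.span {(p : R)}) inferInstance x fun n =>
      (modEq_iff n x 0).2 (by simpa using hx n)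
  constructor
  · intro x y hxy
    refine sub_eq_zero.1 (eq_zero _ fun n => ?_)
    induction n with
    | zero => simp
    | succ n ih =>
      have key : x - y = -(p * h (x - y)) := by
        rw [map_sub]
        linear_combination hxy
      rw [key]
      exact (map_dvd n _ ih).neg_right
  · intro y
    let u : ℕ → R := fun n => (fun x => y - p * h x)^[n] 0
    have u_succ : ∀ n, u (n + 1) = y - p * h (u n) := fun n =>
      Function.iterate_succ_apply' _ _ _
    have u_step : ∀ n, (p : R) ^ n ∣ u n - u (n + 1) := by
      intro n
      induction n with
      | zero => simp
      | succ n ih =>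
        have key : u (n + 1) - u (n + 1 + 1) = -(p * h (u n - u (n + 1))) := by
          rw [u_succ (n + 1), map_sub]
          linear_combination u_succ n
        rw [key]
        exact (map_dvd n _ ih).neg_right
    have u_cauchy : ∀ {m n}, m ≤ n → (p : R) ^ m ∣ u m - u n := by
      intro m n hmn
      induction n, hmn using Nat.le_induction with
      | base => simp
      | succ n hmn ih =>
        rw [← sub_add_sub_cancel (u m) (u n)]
        exact dvd_add ih ((pow_dvd_pow _ hmn).trans (u_step n))
    obtain ⟨x, hx⟩ := IsPrecomplete.prec (I := Ideal.span {(p : R)}) (M := R) inferInstance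
      (f := u) fun hmn => (modEq_iff _ _ _).2 (u_cauchy hmn)
    have hx' : ∀ n, (p : R) ^ n ∣ x - u n := fun n =>
      (dvd_sub_comm).1 ((modEq_iff _ _ _).1 (hx n))
    refine ⟨x, sub_eq_zero.1 (eq_zero _ fun n => ?_)⟩
    have key : x + p * h x - y = (x - u (n + 1)) + p * h (x - u n) := by
      rw [map_sub]
      linear_combination u_succ n
    change (p : R) ^ n ∣ x + p * h x - y
    rw [key]
    exact (pow_dvd_pow _ n.le_succ).trans (dvd_add (hx' (n + 1)) (map_dvd n _ (hx' n)))

/-- On a `p`-adically complete ring, a `p`-divisible perturbation of a bijective additive map by an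
additive map is bijective. -/
theorem IsAdicComplete.bijective_add_natCast_mul {R : Type*} [CommRing R] (p : ℕ)
    [IsAdicComplete (Ideal.span {(p : R)}) R] (e g : R →+ R) (he : Function.Bijective e) :
    Function.Bijective (fun x => e x + (p : R) * g x) := by
  let E : R ≃+ R := AddEquiv.ofBijective e he
  have hE : ∀ x, e (E.symm x) = x := E.apply_symm_apply
  convert he.comp (bijective_id_add_natCast_mul p (E.symm.toAddMonoidHom.comp g)) using 1
  funext x
  have hp : ∀ z, e (p * z) = p * e z := fun z => by
    simpa [nsmul_eq_mul] using map_nsmul e p z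
  simp [hp, hE]


/-- Existence and uniqueness of the constants `ε` of the logarithm:
for every `a ∈ 𝕎(k)` there is a unique `ε` with `∑_{s=0}^{d} b_s · σ^s(ε) = b_0 · a`,
and setting `ε_n := σ^n(ε)` one has `∑_{s=0}^{d} b_s · ε_{n+s} = b_0 · σ^n(a)` for all `n`. -/
theorem witt_epsilon_exists_unique
    {p : ℕ} [Fact p.Prime] {k : Type} [Field k] [Fintype k] [CharP k p]
    (d : ℕ) (hd : 1 ≤ d) (b : ℕ → WittVector p k)
    (hbd : b d = 1)
    (hbfix : ∀ s ≤ d, WittVector.frobenius (b s) = b s)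
    (hbp : ∀ s < d, (p : WittVector p k) ∣ b s)
    (a : WittVector p k) :
    (∃! ε : WittVector p k,
        ∑ s ∈ Finset.range (d + 1), b s * (⇑(WittVector.frobenius))^[s] ε = b 0 * a) ∧
      (∀ ε : WittVector p k,
        (∑ s ∈ Finset.range (d + 1), b s * (⇑(WittVector.frobenius))^[s] ε = b 0 * a) →
        ∀ n : ℕ,
          ∑ s ∈ Finset.range (d + 1), b s * (⇑(WittVector.frobenius))^[n + s] ε
            = b 0 * (⇑(WittVector.frobenius))^[n] a) := by
  have bijective : Function.Bijective fun ε : WittVector p k =>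
      ∑ s ∈ Finset.range (d + 1), b s * (⇑(WittVector.frobenius))^[s] ε := by
    choose! c hc using hbp
    let e : WittVector p k →+ WittVector p k :=
      ((WittVector.frobenius : WittVector p k →+* WittVector p k) ^ d : _ →+* _)
    let g : WittVector p k →+ WittVector p k := ∑ s ∈ Finset.range d,
      (AddMonoidHom.mulLeft (c s)).comp
        ((WittVector.frobenius : WittVector p k →+* WittVector p k) ^ s : _ →+* _).toAddMonoidHom
    have he : Function.Bijective e := by
      change Function.Bijective ⇑((WittVector.frobenius : WittVector p k →+* WittVector p k) ^ d)
      rw [RingHom.coe_pow]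
      exact (WittVector.frobenius_bijective p k).iterate d
    convert IsAdicComplete.bijective_add_natCast_mul p e g he using 1
    funext ε
    rw [Finset.sum_range_succ, hbd, one_mul, add_comm]
    congr 1
    simp only [g, AddMonoidHom.finsetSum_apply, Finset.mul_sum]
    refine Finset.sum_congr rfl fun s hs => ?_
    rw [hc s (Finset.mem_range.1 hs)]
    simp [RingHom.coe_pow, mul_assoc]
  refine ⟨bijective.existsUnique _, fun ε hε n => ?_⟩
  have b_fixed : ∀ s ≤ d, (⇑(WittVector.frobenius))^[n] (b s) = b s := fun s hs =>
    Function.iterate_fixed (hbfix s hs) n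
  have h := congrArg (⇑((WittVector.frobenius : WittVector p k →+* WittVector p k) ^ n)) hε
  rw [map_sum, map_mul, RingHom.coe_pow, b_fixed 0 d.zero_le] at h
  rw [← h]
  refine Finset.sum_congr rfl fun s hs => ?_
  rw [iterate_map_mul WittVector.frobenius,
    b_fixed s (Nat.lt_succ_iff.1 (Finset.mem_range.1 hs)), Function.iterate_add_apply]
end

section
/- For every n ≥ 0, the sequence k ↦ (coefficient of X^n in g_k) converges to 0 in ℚ_p, so that A_n := Σ_{k=0}^{∞} (−1)^k·(coefficient of X^n in g_k) converges in ℚ_p. Moreover A_0 = 0 and n·A_n ∈ ℤ_p for every n ≥ 1; that is, the logarithm l(X) = Σ_{n≥0} A_n X^n is a well-defined element of the ring 𝒫 of power series Σ A_n X^n with A_0 ∈ ℤ_p and n·A_n ∈ ℤ_p for all n ≥ 1. -/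
open Polynomial Filter

section CoeffBound

variable {K : Type*} [NormedField K]

theorem norm_coeff_C_mul_le {c : K} {q : K[X]} {r : ℝ}
    (hq : ∀ n, ‖q.coeff n‖ ≤ r) (n : ℕ) : ‖(C c * q).coeff n‖ ≤ ‖c‖ * r := by
  rw [coeff_C_mul, norm_mul]
  exact mul_le_mul_of_nonneg_left (hq n) (norm_nonneg _)

theorem norm_coeff_X_pow_le_one (m n : ℕ) : ‖(X ^ m : K[X]).coeff n‖ ≤ 1 := by
  rw [coeff_X_pow]
  split_ifs <;> simp

variable [IsUltrametricDist K]

theorem norm_coeff_finset_sum_le {ι : Type*} {s : Finset ι} {q : ι → K[X]} {r : ℝ} (hr : 0 ≤ r)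
    (h : ∀ i ∈ s, ∀ n, ‖(q i).coeff n‖ ≤ r) (n : ℕ) : ‖(∑ i ∈ s, q i).coeff n‖ ≤ r := by
  rw [finsetSum_coeff]
  exact IsUltrametricDist.norm_sum_le_of_forall_le_of_nonneg hr fun i hi => h i hi n

theorem norm_coeff_mul_le {q h : K[X]} {r s : ℝ} (hr : 0 ≤ r)
    (hq : ∀ n, ‖q.coeff n‖ ≤ r) (hh : ∀ n, ‖h.coeff n‖ ≤ s) (n : ℕ) :
    ‖(q * h).coeff n‖ ≤ r * s := by
  have hs : 0 ≤ s := (norm_nonneg _).trans (hh 0)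
  rw [coeff_mul]
  refine IsUltrametricDist.norm_sum_le_of_forall_le_of_nonneg (mul_nonneg hr hs) fun x _ => ?_
  rw [norm_mul]
  exact mul_le_mul (hq _) (hh _) (norm_nonneg _) hr

theorem norm_coeff_pow_le_one {q : K[X]} (hq : ∀ n, ‖q.coeff n‖ ≤ 1) (m n : ℕ) :
    ‖(q ^ m).coeff n‖ ≤ 1 := by
  induction m generalizing n with
  | zero => simpa using norm_coeff_X_pow_le_one (K := K) 0 n
  | succ m ih =>
    rw [pow_succ]
    simpa using norm_coeff_mul_le zero_le_one ih hq n

theorem norm_coeff_comp_le {q h : K[X]} {r : ℝ}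
    (hq : ∀ n, ‖q.coeff n‖ ≤ r) (hh : ∀ n, ‖h.coeff n‖ ≤ 1) (n : ℕ) :
    ‖(q.comp h).coeff n‖ ≤ r := by
  have hr : 0 ≤ r := (norm_nonneg _).trans (hq 0)
  rw [comp_eq_sum_left, Polynomial.sum]
  refine norm_coeff_finset_sum_le hr (fun i _ n => ?_) n
  refine (norm_coeff_C_mul_le (norm_coeff_pow_le_one hh i) n).trans ?_
  simpa using hq i

theorem norm_coeff_derivative_comp_le {q h : K[X]} {r s : ℝ}
    (hq : ∀ n, ‖(derivative q).coeff n‖ ≤ r) (hh : ∀ n, ‖h.coeff n‖ ≤ 1)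
    (hh' : ∀ n, ‖(derivative h).coeff n‖ ≤ s) (n : ℕ) :
    ‖(derivative (q.comp h)).coeff n‖ ≤ s * r := by
  rw [derivative_comp]
  exact norm_coeff_mul_le ((norm_nonneg _).trans (hh' 0)) hh' (norm_coeff_comp_le hq hh) n

end CoeffBound

/-- The logarithm `l(X) = ∑_{k≥0} (−1)^k g_k(X)` is a well-defined element
of the ring `𝒫` of power series `∑ A_n X^n` with `A_0 ∈ ℤ_p` and `n·A_n ∈ ℤ_p` for `n ≥ 1`:
for each `n` the coefficients of `X^n` in `g_k` tend to `0`, the alternating series of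
coefficients converges to some `A_n ∈ ℚ_p`, `A_0 = 0`, and `n·A_n ∈ ℤ_p` for `n ≥ 1`. -/
theorem logarithm_wellDefined
    {p : ℕ} [Fact p.Prime]
    -- the polynomial f(X) = X^p + α_{p-1} X^{p-1} + ⋯ + α_1 X, with α_i ∈ pℤ_p, v_p(α_1) = 1
    (α : ℕ → ℚ_[p])
    (hα : ∀ i, 1 ≤ i → i ≤ p - 1 → ‖α i‖ ≤ (p : ℝ)⁻¹)
    (hα1 : ‖α 1‖ = (p : ℝ)⁻¹)
    (f : ℚ_[p][X])
    (hf : f = X ^ p + ∑ i ∈ Finset.Icc 1 (p - 1), C (α i) * X ^ i)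
    -- the coefficients b_0, …, b_d with b_d = 1, b_i ∈ pℤ_p (i < d), b_0 ≠ 0,
    -- and p·b_0 ∣ p^i·b_i in ℤ_p for 1 ≤ i ≤ d
    (d : ℕ) (hd : 1 ≤ d) (b : ℕ → ℚ_[p])
    (hbd : b d = 1) (hbp : ∀ i < d, ‖b i‖ ≤ (p : ℝ)⁻¹) (hb0 : b 0 ≠ 0)
    (hdvd : ∀ i, 1 ≤ i → i ≤ d → ‖(p : ℚ_[p]) ^ i * b i‖ ≤ ‖(p : ℚ_[p]) * b 0‖)
    -- f^{(i)}: the i-fold composite of f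
    (fc : ℕ → ℚ_[p][X]) (hfc0 : fc 0 = X) (hfcs : ∀ i, fc (i + 1) = (fc i).comp f)
    -- the polynomials g_k: g_0 = X, g_{k+1} = ∑_{i=1}^{d} (b_i/b_0)·g_k(f^{(i)}(X))
    (g : ℕ → ℚ_[p][X]) (hg0 : g 0 = X)
    (hgs : ∀ k, g (k + 1) = ∑ i ∈ Finset.Icc 1 d, C (b i / b 0) * (g k).comp (fc i)) :
    ∀ n : ℕ,
      Tendsto (fun k => (g k).coeff n) atTop (nhds 0) ∧
      ∃ A : ℚ_[p],
        HasSum (fun k => (-1 : ℚ_[p]) ^ k * (g k).coeff n) A ∧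
        (n = 0 → A = 0) ∧
        (1 ≤ n → ‖(n : ℚ_[p]) * A‖ ≤ 1) := by
  have hp0 : (0 : ℝ) < p := by exact_mod_cast (Fact.out : p.Prime).pos
  have hp1 : (1 : ℝ) < p := by exact_mod_cast (Fact.out : p.Prime).one_lt
  have hinv0 : (0 : ℝ) ≤ (p : ℝ)⁻¹ := by positivity
  have hinv1 : (p : ℝ)⁻¹ < 1 := inv_lt_one_of_one_lt₀ hp1
  have hf1 : ∀ n, ‖f.coeff n‖ ≤ 1 := by
    intro n
    rw [hf, coeff_add]
    refine (IsUltrametricDist.norm_add_le_max _ _).trans (max_le (norm_coeff_X_pow_le_one p n) ?_)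
    refine norm_coeff_finset_sum_le zero_le_one (fun i hi n => ?_) n
    rw [Finset.mem_Icc] at hi
    refine (norm_coeff_C_mul_le (norm_coeff_X_pow_le_one i) n).trans ?_
    rw [mul_one]
    exact (hα i hi.1 hi.2).trans hinv1.le
  have hf' : ∀ n, ‖(derivative f).coeff n‖ ≤ (p : ℝ)⁻¹ := by
    intro n
    rw [hf, derivative_add, coeff_add, derivative_X_pow]
    refine (IsUltrametricDist.norm_add_le_max _ _).trans (max_le ?_ ?_)
    · simpa using norm_coeff_C_mul_le (c := (p : ℚ_[p])) (norm_coeff_X_pow_le_one (p - 1)) n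
    · rw [derivative_sum]
      refine norm_coeff_finset_sum_le hinv0 (fun i hi n => ?_) n
      rw [Finset.mem_Icc] at hi
      rw [derivative_C_mul_X_pow]
      refine (norm_coeff_C_mul_le (norm_coeff_X_pow_le_one (i - 1)) n).trans ?_
      rw [mul_one, norm_mul]
      exact (mul_le_of_le_one_right (norm_nonneg _) (IsUltrametricDist.norm_natCast_le_one _ i)).trans
        (hα i hi.1 hi.2)
  have hf_zero : f.eval 0 = 0 := by
    rw [hf, eval_add, eval_finsetSum, eval_X_pow, zero_pow (Fact.out : p.Prime).ne_zero, zero_add]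
    refine Finset.sum_eq_zero fun i hi => ?_
    rw [Finset.mem_Icc] at hi
    simp [show i ≠ 0 by lia]
  have hfc1 : ∀ i n, ‖(fc i).coeff n‖ ≤ 1 := by
    intro i
    induction i with
    | zero => simpa [hfc0] using norm_coeff_X_pow_le_one (K := ℚ_[p]) 1
    | succ i ih => rw [hfcs]; exact norm_coeff_comp_le ih hf1
  have hfc' : ∀ i n, ‖(derivative (fc i)).coeff n‖ ≤ (p : ℝ)⁻¹ ^ i := by
    intro i
    induction i with
    | zero => simpa [hfc0] using norm_coeff_X_pow_le_one (K := ℚ_[p]) 0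
    | succ i ih =>
      intro n
      rw [hfcs, pow_succ']
      exact norm_coeff_derivative_comp_le ih hf1 hf' n
  have hfc_zero : ∀ i, (fc i).eval 0 = 0 := by
    intro i
    induction i with
    | zero => simp [hfc0]
    | succ i ih => rw [hfcs, eval_comp, hf_zero, ih]
  have hcoef : ∀ i, 1 ≤ i → i ≤ d → ‖b i / b 0‖ * (p : ℝ)⁻¹ ^ i ≤ (p : ℝ)⁻¹ := by
    intro i hi hid
    have h := hdvd i hi hid
    rw [norm_mul, norm_mul, norm_pow, Padic.norm_p] at h
    rw [norm_div, div_mul_eq_mul_div, div_le_iff₀ (norm_pos_iff.mpr hb0), mul_comm]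
    exact h
  have hg' : ∀ k n, ‖(derivative (g k)).coeff n‖ ≤ (p : ℝ)⁻¹ ^ k := by
    intro k
    induction k with
    | zero => simpa [hg0] using norm_coeff_X_pow_le_one (K := ℚ_[p]) 0
    | succ k ih =>
      rw [hgs, derivative_sum]
      refine norm_coeff_finset_sum_le (by positivity) fun i hi n => ?_
      rw [Finset.mem_Icc] at hi
      rw [derivative_C_mul]
      refine (norm_coeff_C_mul_le
        (norm_coeff_derivative_comp_le ih (hfc1 i) (hfc' i)) n).trans ?_
      rw [← mul_assoc, pow_succ']
      exact mul_le_mul_of_nonneg_right (hcoef i hi.1 hi.2) (by positivity)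
  have hg_zero : ∀ k, (g k).eval 0 = 0 := by
    intro k
    induction k with
    | zero => simp [hg0]
    | succ k ih =>
      rw [hgs, eval_finsetSum]
      exact Finset.sum_eq_zero fun i _ => by
        rw [eval_mul, eval_comp, hfc_zero, ih, mul_zero]
  intro n
  rcases n with _ | n
  · have h : ∀ k, (g k).coeff 0 = 0 := fun k => by rw [coeff_zero_eq_eval_zero, hg_zero]
    refine ⟨by simp [h], 0, by simp [h], fun _ => rfl, fun h => by lia⟩
  have hbound : ∀ k, ‖((n + 1 : ℕ) : ℚ_[p]) * (g k).coeff (n + 1)‖ ≤ (p : ℝ)⁻¹ ^ k := by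
    intro k
    have h := hg' k n
    rw [coeff_derivative, mul_comm] at h
    exact_mod_cast h
  have hn : ((n + 1 : ℕ) : ℚ_[p]) ≠ 0 := Nat.cast_ne_zero.mpr n.succ_ne_zero
  have hcoeff : ∀ k, ‖(g k).coeff (n + 1)‖ ≤ ‖((n + 1 : ℕ) : ℚ_[p])‖⁻¹ * (p : ℝ)⁻¹ ^ k := by
    intro k
    rw [← div_eq_inv_mul, le_div_iff₀' (norm_pos_iff.mpr hn), ← norm_mul]
    exact hbound k
  have hgeom : Summable fun k => ‖((n + 1 : ℕ) : ℚ_[p])‖⁻¹ * (p : ℝ)⁻¹ ^ k :=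
    (summable_geometric_of_lt_one hinv0 hinv1).mul_left _
  have hsum : Summable fun k => (-1 : ℚ_[p]) ^ k * (g k).coeff (n + 1) :=
    Summable.of_norm_bounded hgeom fun k => by simpa using hcoeff k
  refine ⟨squeeze_zero_norm hcoeff hgeom.tendsto_atTop_zero, _, hsum.hasSum,
    fun h => by lia, fun _ => ?_⟩
  rw [← tsum_mul_left]
  refine IsUltrametricDist.norm_tsum_le_of_forall_le_of_nonneg zero_le_one fun k => ?_
  have h := (hbound k).trans (pow_le_one₀ hinv0 hinv1.le)
  rw [mul_left_comm, norm_mul]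
  simpa using h
end

section
/- Assume π_0 = 0 and, for every n ≥ 1, π_n ≠ 0 and f(π_n) = π_{n−1}. Then for each m ≥ 0 the series ℓ_m := Σ_{k=0}^{∞} (−1)^k·g_k(π_m) converges in the finite extension ℚ_p(π_m) of ℚ_p. Set ε := (b_0·α_{p−1})/(p·(b_0 + b_1 + ⋯ + b_d)) ∈ ℚ_p. Then for all integers n, i with 0 ≤ i < d, n − d ≥ 1 and n − d − i ≥ 0, one has Σ_{s=0}^{d} p^s·b_s·Tr_{ℚ_p(π_{n−s})/ℚ_p(π_{n−d})}(ε + ℓ_{n−s−i}) = 0, where Tr denotes the field trace (note that ℚ_p(π_{n−d}) ⊆ ℚ_p(π_{n−s}) and ε + ℓ_{n−s−i} ∈ ℚ_p(π_{n−s}), since π_m = f^{(n−s−m)}(π_{n−s}) for m ≤ n−s). -/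
open Polynomial
open scoped Classical

/-- The relative field trace `Tr_{E/F}` for intermediate fields `F ≤ E` of `K/ℚ_p`,
viewed as taking values in `K` (junk value `0` if `F ≰ E` or the element is not in `E`). -/
noncomputable def relTrace {p : ℕ} [Fact p.Prime] {K : Type} [Field K] [Algebra ℚ_[p] K]
    (F E : IntermediateField ℚ_[p] K) (x : K) : K :=
  if h : F ≤ E ∧ x ∈ E then
    letI : Algebra F E := ((IntermediateField.inclusion h.1).toRingHom).toAlgebra
    ((Algebra.trace F E ⟨x, h.2⟩ : F) : K)
  else 0

/-- If `x` generates `E` over a subfield `k` of `F`, and `q` is a monic polynomial over `F` of degree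
`[E : F]` that kills `x`, then the trace of `x` is minus the second coefficient of `q`. -/
theorem Algebra.trace_eq_neg_nextCoeff_of_natDegree_eq_finrank {k F E : Type*} [Field k] [Field F]
    [Field E] [Algebra k F] [Algebra k E] [Algebra F E] [IsScalarTower k F E]
    [FiniteDimensional F E] {x : E} (hx : IntermediateField.adjoin k {x} = ⊤) {q : F[X]}
    (hq : q.Monic) (hqx : aeval x q = 0) (hdeg : q.natDegree = Module.finrank F E) :
    Algebra.trace F E x = -q.nextCoeff := by
  have hint : IsIntegral F x := .of_finite F x
  have htop : IntermediateField.adjoin F {x} = ⊤ := by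
    refine top_unique fun y _ => ?_
    have hle : IntermediateField.adjoin k {x} ≤
        (IntermediateField.adjoin F {x}).restrictScalars k := by
      rw [IntermediateField.adjoin_simple_le_iff]
      exact IntermediateField.mem_adjoin_simple_self F x
    exact hle (hx ▸ IntermediateField.mem_top)
  have hmin : q = minpoly F x := by
    refine (eq_of_monic_of_dvd_of_natDegree_le (minpoly.monic hint) hq (minpoly.dvd F x hqx) ?_)
    rw [hdeg, ← IntermediateField.adjoin.finrank hint, htop, IntermediateField.finrank_top']
  rw [trace_eq_finrank_mul_minpoly_nextCoeff, htop, IntermediateField.finrank_top, ← hmin]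
  simp

section RelTrace

variable {p : ℕ} [Fact p.Prime] {K : Type} [Field K] [Algebra ℚ_[p] K]
  {F E L : IntermediateField ℚ_[p] K}

/-- The relative trace from `E` to `F`, as a linear map. -/
noncomputable def relTraceLinearMap (h : F ≤ E) : E →ₗ[ℚ_[p]] K :=
  letI : Algebra F E := ((IntermediateField.inclusion h).toRingHom).toAlgebra
  haveI : IsScalarTower ℚ_[p] F E := .of_algebraMap_eq fun _ => rfl
  F.val.toLinearMap ∘ₗ (Algebra.trace F E).restrictScalars ℚ_[p]

theorem relTrace_eq_relTraceLinearMap (h : F ≤ E) {x : K} (hx : x ∈ E) :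
    relTrace F E x = relTraceLinearMap h ⟨x, hx⟩ := by
  rw [relTrace, dif_pos ⟨h, hx⟩]
  rfl

theorem relTrace_mem (F E : IntermediateField ℚ_[p] K) (x : K) : relTrace F E x ∈ F := by
  rw [relTrace]
  split_ifs with h
  · exact Subtype.coe_prop _
  · exact F.zero_mem

theorem relTrace_algebraMap_mul (h : F ≤ E) (c : ℚ_[p]) {x : K} (hx : x ∈ E) :
    relTrace F E (algebraMap ℚ_[p] K c * x) = algebraMap ℚ_[p] K c * relTrace F E x := by
  rw [relTrace_eq_relTraceLinearMap h (E.mul_mem (E.algebraMap_mem c) hx),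
    relTrace_eq_relTraceLinearMap h hx]
  refine (congrArg (relTraceLinearMap h) (Subtype.ext ?_)).trans
    ((map_smul (relTraceLinearMap h) c ⟨x, hx⟩).trans (Algebra.smul_def _ _))
  exact (Algebra.smul_def c x).symm

theorem relTrace_add (h : F ≤ E) {x y : K} (hx : x ∈ E) (hy : y ∈ E) :
    relTrace F E (x + y) = relTrace F E x + relTrace F E y := by
  rw [relTrace_eq_relTraceLinearMap h (E.add_mem hx hy), relTrace_eq_relTraceLinearMap h hx,
    relTrace_eq_relTraceLinearMap h hy, ← map_add]
  rfl

theorem relTrace_sum (h : F ≤ E) {ι : Type*} (s : Finset ι) {x : ι → K}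
    (hx : ∀ i ∈ s, x i ∈ E) :
    relTrace F E (∑ i ∈ s, x i) = ∑ i ∈ s, relTrace F E (x i) := by
  induction s using Finset.induction_on with
  | empty => simpa using relTrace_algebraMap_mul h 0 E.zero_mem
  | insert a s ha ih =>
    rw [Finset.sum_insert ha, Finset.sum_insert ha, relTrace_add h (hx a (by simp))
      (E.sum_mem fun i hi => hx i (by simp [hi])), ih fun i hi => hx i (by simp [hi])]

theorem relTrace_relTrace [FiniteDimensional ℚ_[p] E] [FiniteDimensional ℚ_[p] L]
    (hFE : F ≤ E) (hEL : E ≤ L) {x : K} (hx : x ∈ L) :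
    relTrace F E (relTrace E L x) = relTrace F L x := by
  let : Algebra F E := ((IntermediateField.inclusion hFE).toRingHom).toAlgebra
  let : Algebra E L := ((IntermediateField.inclusion hEL).toRingHom).toAlgebra
  let : Algebra F L := ((IntermediateField.inclusion (hFE.trans hEL)).toRingHom).toAlgebra
  have : IsScalarTower F E L := .of_algebraMap_eq fun _ => rfl
  have : IsScalarTower ℚ_[p] F E := .of_algebraMap_eq fun _ => rfl
  have : IsScalarTower ℚ_[p] E L := .of_algebraMap_eq fun _ => rfl
  have : FiniteDimensional F E := .right ℚ_[p] F E
  have : FiniteDimensional E L := .right ℚ_[p] E L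
  have hE : relTrace E L x = (Algebra.trace E L ⟨x, hx⟩ : E) := dif_pos ⟨hEL, hx⟩
  have hF : relTrace F L x = (Algebra.trace F L ⟨x, hx⟩ : F) := dif_pos ⟨hFE.trans hEL, hx⟩
  rw [hE, hF, relTrace, dif_pos ⟨hFE, Subtype.coe_prop _⟩]
  have : Module.Free F E := .of_divisionRing F E
  have : Module.Free E L := .of_divisionRing E L
  exact congrArg (algebraMap F K) (Algebra.trace_trace (⟨x, hx⟩ : L))

theorem relTrace_of_mem [FiniteDimensional ℚ_[p] F] (h : F ≤ E) {N : ℕ}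
    (hN : Module.finrank ℚ_[p] E = Module.finrank ℚ_[p] F * N) {x : K} (hx : x ∈ F) :
    relTrace F E x = N * x := by
  let : Algebra F E := ((IntermediateField.inclusion h).toRingHom).toAlgebra
  have : IsScalarTower ℚ_[p] F E := .of_algebraMap_eq fun _ => rfl
  have hfin : Module.finrank F E = N := by
    refine Nat.eq_of_mul_eq_mul_left (Module.finrank_pos (R := ℚ_[p]) (M := F)) ?_
    rw [Module.finrank_mul_finrank, hN]
  rw [relTrace, dif_pos ⟨h, h hx⟩]
  have := Algebra.trace_algebraMap (S := E) (⟨x, hx⟩ : F)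
  rw [hfin] at this
  rw [nsmul_eq_mul] at this
  exact (congrArg (algebraMap F K) this).trans (by rw [map_mul, map_natCast]; rfl)

theorem relTrace_adjoin_simple [FiniteDimensional ℚ_[p] F] {x : K}
    (h : F ≤ IntermediateField.adjoin ℚ_[p] {x}) {q : F[X]} (hq : q.Monic) (hqx : aeval x q = 0)
    (hx : IsIntegral ℚ_[p] x)
    (hdeg : Module.finrank ℚ_[p] (IntermediateField.adjoin ℚ_[p] {x}) =
      Module.finrank ℚ_[p] F * q.natDegree) :
    relTrace F (IntermediateField.adjoin ℚ_[p] {x}) x = -(q.nextCoeff : K) := by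
  set E := IntermediateField.adjoin ℚ_[p] {x} with hE
  let : Algebra F E := ((IntermediateField.inclusion h).toRingHom).toAlgebra
  have : IsScalarTower ℚ_[p] F E := .of_algebraMap_eq fun _ => rfl
  have : IsScalarTower F E K := .of_algebraMap_eq fun _ => rfl
  have : FiniteDimensional ℚ_[p] E := IntermediateField.adjoin.finiteDimensional hx
  have : FiniteDimensional F E := .right ℚ_[p] F E
  have hfin : q.natDegree = Module.finrank F E := by
    refine Nat.eq_of_mul_eq_mul_left (Module.finrank_pos (R := ℚ_[p]) (M := F)) ?_
    rw [Module.finrank_mul_finrank, hdeg]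
  have hxE : x ∈ E := IntermediateField.mem_adjoin_simple_self _ x
  have htop : IntermediateField.adjoin ℚ_[p] {(⟨x, hxE⟩ : E)} = ⊤ := by
    apply IntermediateField.lift_injective E
    rw [IntermediateField.lift_adjoin_simple, IntermediateField.lift_top]
  have hqx' : aeval (⟨x, hxE⟩ : E) q = 0 := by
    apply (algebraMap E K).injective
    rw [← aeval_algebraMap_apply, map_zero]
    exact hqx
  rw [relTrace, dif_pos ⟨h, hxE⟩,
    Algebra.trace_eq_neg_nextCoeff_of_natDegree_eq_finrank htop hq hqx' hfin]
  simp

end RelTrace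

/-- If `H` and `F` are monic and reduce to powers of `X` modulo the prime ideal `P`, with
`F(0) = 0` and `H(0) ∉ P²`, then `H ∘ F ∘ ⋯ ∘ F` is irreducible. -/
theorem Polynomial.irreducible_iterate_comp_of_map_eq_X_pow {R : Type*} [CommRing R] [IsDomain R]
    {P : Ideal R} (hP : P.IsPrime) {F H : R[X]} (hF : F.Monic) (hH : H.Monic)
    (hF0 : F.eval 0 = 0) (hH0 : H.eval 0 ∉ P ^ 2) (hFd : F.natDegree ≠ 0) (hHd : H.natDegree ≠ 0)
    (hFP : F.map (Ideal.Quotient.mk P) = X ^ F.natDegree)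
    (hHP : H.map (Ideal.Quotient.mk P) = X ^ H.natDegree) (m : ℕ) :
    ((fun q : R[X] => q.comp F)^[m] H).Monic ∧
      ((fun q : R[X] => q.comp F)^[m] H).natDegree = F.natDegree ^ m * H.natDegree ∧
      Irreducible ((fun q : R[X] => q.comp F)^[m] H) := by
  set G : R[X] := (fun q : R[X] => q.comp F)^[m] H with hG
  have key : G.Monic ∧ G.natDegree = F.natDegree ^ m * H.natDegree ∧ G.eval 0 = H.eval 0 ∧
      G.map (Ideal.Quotient.mk P) = X ^ G.natDegree := by
    rw [hG]
    clear hG G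
    induction m with
    | zero => simp [hH, hHP]
    | succ m ih =>
      obtain ⟨h1, h2, h3, h4⟩ := ih
      rw [Function.iterate_succ_apply']
      refine ⟨h1.comp hF hFd, ?_, ?_, ?_⟩
      · rw [natDegree_comp, h2]
        ring
      · rw [eval_comp, hF0, h3]
      · rw [Polynomial.map_comp, h4, hFP, natDegree_comp, X_pow_comp, ← pow_mul, mul_comm]
  obtain ⟨h1, h2, h3, h4⟩ := key
  refine ⟨h1, h2, ?_⟩
  refine (h1.isEisensteinAt_of_mem_of_notMem (𝓟 := P) hP.ne_top (fun {n} hn => ?_) ?_).irreducible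
    hP h1.isPrimitive ?_
  · rw [← Ideal.Quotient.eq_zero_iff_mem, ← coeff_map, h4, coeff_X_pow, if_neg hn.ne]
  · rwa [coeff_zero_eq_eval_zero, h3]
  · rw [h2]
    positivity

theorem Polynomial.degree_sum_C_mul_X_pow_lt {R ι : Type*} [Semiring R] {s : Finset ι} {n : ℕ}
    (a : ι → R) {e : ι → ℕ} (he : ∀ i ∈ s, e i < n) :
    (∑ i ∈ s, C (a i) * X ^ e i).degree < (n : WithBot ℕ) := by
  refine (degree_sum_le _ _).trans_lt ((Finset.sup_lt_iff (WithBot.bot_lt_coe n)).2 fun i hi => ?_)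
  exact (degree_C_mul_X_pow_le _ _).trans_lt (WithBot.coe_lt_coe.2 (he i hi))

section Tower

variable {p : ℕ} [Fact p.Prime] {K : Type} [Field K] [Algebra ℚ_[p] K] {α : ℕ → ℚ_[p]}
  {f : ℚ_[p][X]} {π : ℕ → K}

/-- In a tower `f(π_{n+1}) = π_n` above `π_0 = 0`, with `f` congruent to `X^p` modulo `p` and of
linear coefficient of valuation one, `π_{m+1}` has degree `p^m (p - 1)` over `ℚ_p`. -/
theorem finrank_adjoin_tower (hα : ∀ i, 1 ≤ i → i ≤ p - 1 → ‖α i‖ ≤ (p : ℝ)⁻¹)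
    (hα1 : ‖α 1‖ = (p : ℝ)⁻¹)
    (hf : f = X ^ p + ∑ i ∈ Finset.Icc 1 (p - 1), C (α i) * X ^ i) (hπ0 : π 0 = 0)
    (hπ : ∀ n : ℕ, aeval (π (n + 1)) f = π n) (hπ1 : π 1 ≠ 0) (m : ℕ) :
    IsIntegral ℚ_[p] (π (m + 1)) ∧
      Module.finrank ℚ_[p] (IntermediateField.adjoin ℚ_[p] {π (m + 1)}) = p ^ m * (p - 1) := by
  have hp : 2 ≤ p := (Fact.out : p.Prime).two_le
  have hp1 : ((p : ℝ)⁻¹) ≤ 1 := inv_le_one_of_one_le₀ (by exact_mod_cast (by lia : 1 ≤ p))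
  set P : Ideal ℤ_[p] := Ideal.span {(p : ℤ_[p])} with hPdef
  have hP : P.IsPrime := (Ideal.span_singleton_prime PadicInt.prime_p.ne_zero).2 PadicInt.prime_p
  obtain ⟨a, ha⟩ : ∃ a : ℕ → ℤ_[p], ∀ i ∈ Finset.Icc 1 (p - 1), (a i : ℚ_[p]) = α i := by
    refine ⟨fun i => if h : ‖α i‖ ≤ 1 then ⟨α i, h⟩ else 0, fun i hi => ?_⟩
    rw [Finset.mem_Icc] at hi
    simp [(hα i hi.1 hi.2).trans hp1]
  have haP : ∀ i ∈ Finset.Icc 1 (p - 1), a i ∈ P := by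
    intro i hi
    have := (PadicInt.norm_le_pow_iff_mem_span_pow (a i) 1).1
    simp only [Nat.cast_one, zpow_neg_one, pow_one] at this
    apply this
    rw [PadicInt.norm_def, ha i hi]
    rw [Finset.mem_Icc] at hi
    exact hα i hi.1 hi.2
  have hamap : ∀ i ∈ Finset.Icc 1 (p - 1), Ideal.Quotient.mk P (a i) = 0 := fun i hi =>
    Ideal.Quotient.eq_zero_iff_mem.2 (haP i hi)
  set F : ℤ_[p][X] := X ^ p + ∑ i ∈ Finset.Icc 1 (p - 1), C (a i) * X ^ i with hF
  set H : ℤ_[p][X] := X ^ (p - 1) + ∑ i ∈ Finset.Icc 1 (p - 1), C (a i) * X ^ (i - 1) with hH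
  have hFdeg : (∑ i ∈ Finset.Icc 1 (p - 1), C (a i) * X ^ i).degree < (p : WithBot ℕ) :=
    degree_sum_C_mul_X_pow_lt a fun i hi => by rw [Finset.mem_Icc] at hi; lia
  have hHdeg : (∑ i ∈ Finset.Icc 1 (p - 1), C (a i) * X ^ (i - 1)).degree <
      ((p - 1 : ℕ) : WithBot ℕ) :=
    degree_sum_C_mul_X_pow_lt a fun i hi => by rw [Finset.mem_Icc] at hi; lia
  have hFd : F.natDegree = p := natDegree_eq_of_degree_eq_some
    ((degree_add_eq_left_of_degree_lt (by rwa [degree_X_pow])).trans (degree_X_pow p))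
  have hHd : H.natDegree = p - 1 := natDegree_eq_of_degree_eq_some
    ((degree_add_eq_left_of_degree_lt (by rwa [degree_X_pow])).trans (degree_X_pow _))
  have hFmap : F.map (algebraMap ℤ_[p] ℚ_[p]) = f := by
    rw [hF, hf, Polynomial.map_add, Polynomial.map_sum]
    congr 1
    · simp
    · refine Finset.sum_congr rfl fun i hi => ?_
      rw [Polynomial.map_mul, map_C, Polynomial.map_pow, map_X, ← ha i hi]
      rfl
  have hXH : X * H = F := by
    rw [hF, hH, mul_add, ← pow_succ', Nat.sub_add_cancel (by lia), Finset.mul_sum]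
    congr 1
    refine Finset.sum_congr rfl fun i hi => ?_
    rw [Finset.mem_Icc] at hi
    rw [mul_left_comm, ← pow_succ', Nat.sub_add_cancel hi.1]
  have hH0 : H.eval 0 = a 1 := by
    rw [hH, eval_add, eval_finsetSum, Finset.sum_eq_single 1]
    · simp
      lia
    · intro i hi hi1
      rw [Finset.mem_Icc] at hi
      simp [show i - 1 ≠ 0 by lia]
    · intro h
      exact absurd (Finset.mem_Icc.2 ⟨le_rfl, by lia⟩) h
  have ha1 : a 1 ∉ P ^ 2 := by
    rw [hPdef, Ideal.span_singleton_pow, ← PadicInt.norm_le_pow_iff_mem_span_pow,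
      PadicInt.norm_def, ha 1 (Finset.mem_Icc.2 ⟨le_rfl, by lia⟩), hα1, not_le, ← zpow_neg_one]
    exact zpow_lt_zpow_right₀ (by exact_mod_cast (by lia : 1 < p)) (by norm_num)
  obtain ⟨h1, h2, h3⟩ := irreducible_iterate_comp_of_map_eq_X_pow hP
    (monic_X_pow_add hFdeg) (monic_X_pow_add hHdeg)
    (by rw [← hF, ← hXH]; simp) (by rw [← hH, hH0]; exact ha1) (by rw [← hF, hFd]; lia)
    (by rw [← hH, hHd]; lia)
    (by
      rw [← hF, hFd, hF, Polynomial.map_add, Polynomial.map_sum, Finset.sum_eq_zero]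
      · simp
      · intro i hi
        simp [hamap i hi])
    (by
      rw [← hH, hHd, hH, Polynomial.map_add, Polynomial.map_sum, Finset.sum_eq_zero]
      · simp
      · intro i hi
        simp [hamap i hi]) m
  rw [← hF, ← hH] at h1 h2 h3
  set G : ℤ_[p][X] := (fun q : ℤ_[p][X] => q.comp F)^[m] H with hG
  have hroot : aeval (π (m + 1)) (G.map (algebraMap ℤ_[p] ℚ_[p])) = 0 := by
    rw [hG]
    clear h1 h2 h3 hG G
    induction m with
    | zero =>
      have h := hπ 0
      rw [hπ0, ← hFmap, ← hXH, Polynomial.map_mul, map_X, map_mul, aeval_X] at h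
      exact (mul_eq_zero.1 h).resolve_left hπ1
    | succ m ih =>
      rw [Function.iterate_succ_apply', Polynomial.map_comp, aeval_comp, hFmap, hπ, ih]
  have hmin : G.map (algebraMap ℤ_[p] ℚ_[p]) = minpoly ℚ_[p] (π (m + 1)) :=
    minpoly.eq_of_irreducible_of_monic
      ((h1.irreducible_iff_irreducible_map_fraction_map (K := ℚ_[p])).1 h3) hroot (h1.map _)
  have hint : IsIntegral ℚ_[p] (π (m + 1)) := ⟨_, h1.map _, hroot⟩
  refine ⟨hint, ?_⟩
  rw [IntermediateField.adjoin.finrank hint, ← hmin, h1.natDegree_map, h2, hFd, hHd]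

theorem finiteDimensional_adjoin_tower (hα : ∀ i, 1 ≤ i → i ≤ p - 1 → ‖α i‖ ≤ (p : ℝ)⁻¹)
    (hα1 : ‖α 1‖ = (p : ℝ)⁻¹)
    (hf : f = X ^ p + ∑ i ∈ Finset.Icc 1 (p - 1), C (α i) * X ^ i) (hπ0 : π 0 = 0)
    (hπ : ∀ n : ℕ, aeval (π (n + 1)) f = π n) (hπ1 : π 1 ≠ 0) {m : ℕ} (hm : 1 ≤ m) :
    FiniteDimensional ℚ_[p] (IntermediateField.adjoin ℚ_[p] {π m}) := by
  obtain ⟨m, rfl⟩ := Nat.exists_eq_add_of_le' hm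
  exact IntermediateField.adjoin.finiteDimensional (finrank_adjoin_tower hα hα1 hf hπ0 hπ hπ1 m).1

theorem adjoin_tower_mono (hπ : ∀ n : ℕ, aeval (π (n + 1)) f = π n) {m n : ℕ} (h : m ≤ n) :
    IntermediateField.adjoin ℚ_[p] {π m} ≤ IntermediateField.adjoin ℚ_[p] {π n} := by
  refine monotone_nat_of_le_succ (f := fun m => IntermediateField.adjoin ℚ_[p] {π m})
    (fun m => ?_) h
  rw [IntermediateField.adjoin_simple_le_iff, ← hπ m]
  exact IntermediateField.algebra_adjoin_le_adjoin _ _ (aeval_mem_adjoin_singleton _ _)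

theorem relTrace_tower_of_mem (hα : ∀ i, 1 ≤ i → i ≤ p - 1 → ‖α i‖ ≤ (p : ℝ)⁻¹)
    (hα1 : ‖α 1‖ = (p : ℝ)⁻¹)
    (hf : f = X ^ p + ∑ i ∈ Finset.Icc 1 (p - 1), C (α i) * X ^ i) (hπ0 : π 0 = 0)
    (hπ : ∀ n : ℕ, aeval (π (n + 1)) f = π n) (hπ1 : π 1 ≠ 0) {m n : ℕ} (hm : 1 ≤ m) (hmn : m ≤ n)
    {x : K} (hx : x ∈ IntermediateField.adjoin ℚ_[p] {π m}) :
    relTrace (IntermediateField.adjoin ℚ_[p] {π m}) (IntermediateField.adjoin ℚ_[p] {π n}) x =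
      (p : K) ^ (n - m) * x := by
  obtain ⟨m, rfl⟩ := Nat.exists_eq_add_of_le' hm
  obtain ⟨e, rfl⟩ := Nat.exists_eq_add_of_le hmn
  obtain ⟨hint, hm'⟩ := finrank_adjoin_tower hα hα1 hf hπ0 hπ hπ1 m
  obtain ⟨-, hn'⟩ := finrank_adjoin_tower hα hα1 hf hπ0 hπ hπ1 (m + e)
  have := IntermediateField.adjoin.finiteDimensional hint
  rw [relTrace_of_mem (adjoin_tower_mono hπ hmn) (N := p ^ e) ?_ hx, Nat.add_sub_cancel_left,
    Nat.cast_pow]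
  rw [hm', add_right_comm, hn']
  ring

theorem relTrace_tower_of_mem_of_le (hα : ∀ i, 1 ≤ i → i ≤ p - 1 → ‖α i‖ ≤ (p : ℝ)⁻¹)
    (hα1 : ‖α 1‖ = (p : ℝ)⁻¹)
    (hf : f = X ^ p + ∑ i ∈ Finset.Icc 1 (p - 1), C (α i) * X ^ i) (hπ0 : π 0 = 0)
    (hπ : ∀ n : ℕ, aeval (π (n + 1)) f = π n) (hπ1 : π 1 ≠ 0) {k m n : ℕ} (hk : 1 ≤ k)
    (hkm : k ≤ m) (hmn : m ≤ n) {x : K} (hx : x ∈ IntermediateField.adjoin ℚ_[p] {π m}) :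
    relTrace (IntermediateField.adjoin ℚ_[p] {π k}) (IntermediateField.adjoin ℚ_[p] {π n}) x =
      (p : K) ^ (n - m) * relTrace (IntermediateField.adjoin ℚ_[p] {π k})
        (IntermediateField.adjoin ℚ_[p] {π m}) x := by
  have := finiteDimensional_adjoin_tower hα hα1 hf hπ0 hπ hπ1 (hk.trans hkm)
  have := finiteDimensional_adjoin_tower hα hα1 hf hπ0 hπ hπ1 (hk.trans (hkm.trans hmn))
  have hcast : (p : K) ^ (n - m) = algebraMap ℚ_[p] K ((p : ℚ_[p]) ^ (n - m)) := by simp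
  rw [← relTrace_relTrace (adjoin_tower_mono hπ hkm) (adjoin_tower_mono hπ hmn)
      (adjoin_tower_mono hπ hmn hx),
    relTrace_tower_of_mem hα hα1 hf hπ0 hπ hπ1 (hk.trans hkm) hmn hx, hcast,
    relTrace_algebraMap_mul (adjoin_tower_mono hπ hkm) _ hx]

theorem relTrace_tower_succ_gen (hα : ∀ i, 1 ≤ i → i ≤ p - 1 → ‖α i‖ ≤ (p : ℝ)⁻¹)
    (hα1 : ‖α 1‖ = (p : ℝ)⁻¹)
    (hf : f = X ^ p + ∑ i ∈ Finset.Icc 1 (p - 1), C (α i) * X ^ i) (hπ0 : π 0 = 0)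
    (hπ : ∀ n : ℕ, aeval (π (n + 1)) f = π n) (hπ1 : π 1 ≠ 0) {m : ℕ} (hm : 1 ≤ m) :
    relTrace (IntermediateField.adjoin ℚ_[p] {π m}) (IntermediateField.adjoin ℚ_[p] {π (m + 1)})
      (π (m + 1)) = -algebraMap ℚ_[p] K (α (p - 1)) := by
  have hp : 2 ≤ p := (Fact.out : p.Prime).two_le
  obtain ⟨m, rfl⟩ := Nat.exists_eq_add_of_le' hm
  obtain ⟨hint, hm'⟩ := finrank_adjoin_tower hα hα1 hf hπ0 hπ hπ1 m
  obtain ⟨hint1, hn'⟩ := finrank_adjoin_tower hα hα1 hf hπ0 hπ hπ1 (m + 1)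
  have := IntermediateField.adjoin.finiteDimensional hint
  set F := IntermediateField.adjoin ℚ_[p] {π (m + 1)} with hF
  have hdeg : (∑ i ∈ Finset.Icc 1 (p - 1), C (α i) * X ^ i).degree < (p : WithBot ℕ) :=
    degree_sum_C_mul_X_pow_lt α fun i hi => by rw [Finset.mem_Icc] at hi; lia
  have hfm : f.Monic := hf ▸ monic_X_pow_add hdeg
  have hfd : f.degree = p :=
    hf ▸ (degree_add_eq_left_of_degree_lt (by rwa [degree_X_pow])).trans (degree_X_pow p)
  have hfc : f.coeff (p - 1) = α (p - 1) := by
    rw [hf, coeff_add, coeff_X_pow, if_neg (by lia), finsetSum_coeff, zero_add,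
      Finset.sum_eq_single (p - 1)]
    · simp
    · intro i _ hi
      rw [coeff_C_mul_X_pow, if_neg hi.symm]
    · intro h
      exact absurd (Finset.mem_Icc.2 ⟨by lia, le_rfl⟩) h
  have hmem : π (m + 1) ∈ F := IntermediateField.mem_adjoin_simple_self _ _
  set q : F[X] := f.map (algebraMap ℚ_[p] F) - C ⟨π (m + 1), hmem⟩ with hq
  have hqd : q.natDegree = p := by
    rw [hq, natDegree_sub_C, natDegree_map, natDegree_eq_of_degree_eq_some hfd]
  have hqm : q.Monic := by
    refine (hfm.map _).sub_of_left (degree_C_le.trans_lt ?_)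
    rw [degree_map, hfd]
    exact_mod_cast (by lia : 0 < p)
  have hqx : aeval (π (m + 1 + 1)) q = 0 := by
    rw [hq, map_sub, aeval_map_algebraMap, hπ, aeval_C, sub_eq_zero]
    rfl
  rw [relTrace_adjoin_simple (adjoin_tower_mono hπ (by lia)) hqm hqx hint1
    (by rw [hn', hm', hqd]; ring), nextCoeff_of_natDegree_pos (by rw [hqd]; lia), hqd, hq, coeff_sub,
    coeff_map, hfc, coeff_C, if_neg (by lia), sub_zero]
  rfl

theorem relTrace_tower_gen (hα : ∀ i, 1 ≤ i → i ≤ p - 1 → ‖α i‖ ≤ (p : ℝ)⁻¹)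
    (hα1 : ‖α 1‖ = (p : ℝ)⁻¹)
    (hf : f = X ^ p + ∑ i ∈ Finset.Icc 1 (p - 1), C (α i) * X ^ i) (hπ0 : π 0 = 0)
    (hπ : ∀ n : ℕ, aeval (π (n + 1)) f = π n) (hπ1 : π 1 ≠ 0) {k m n : ℕ} (hk : 1 ≤ k)
    (hkm : k < m) (hmn : m ≤ n) :
    relTrace (IntermediateField.adjoin ℚ_[p] {π k}) (IntermediateField.adjoin ℚ_[p] {π n}) (π m) =
      -((p : K) ^ (n - 1 - k) * algebraMap ℚ_[p] K (α (p - 1))) := by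
  obtain ⟨m, rfl⟩ := Nat.exists_eq_add_of_le' (hk.trans hkm.le)
  have hkm' : k ≤ m := by lia
  have := finiteDimensional_adjoin_tower hα hα1 hf hπ0 hπ hπ1 (hk.trans hkm')
  have := finiteDimensional_adjoin_tower hα hα1 hf hπ0 hπ hπ1 m.succ_pos
  have hmem := IntermediateField.mem_adjoin_simple_self ℚ_[p] (π (m + 1))
  rw [relTrace_tower_of_mem_of_le hα hα1 hf hπ0 hπ hπ1 hk hkm.le hmn hmem,
    ← relTrace_relTrace (adjoin_tower_mono hπ hkm') (adjoin_tower_mono hπ m.le_succ) hmem,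
    relTrace_tower_succ_gen hα hα1 hf hπ0 hπ hπ1 (hk.trans hkm'), ← map_neg,
    relTrace_tower_of_mem_of_le hα hα1 hf hπ0 hπ hπ1 hk le_rfl hkm'
      (IntermediateField.algebraMap_mem _ _),
    relTrace_tower_of_mem hα hα1 hf hπ0 hπ hπ1 hk le_rfl (IntermediateField.algebraMap_mem _ _),
    show n - 1 - k = (n - (m + 1)) + (m - k) by lia, pow_add, map_neg, Nat.sub_self, pow_zero]
  ring

end Tower

section Recursion

variable {K : Type*} [CommRing K] {a : ℕ → ℕ → K} {π c : ℕ → K} {d : ℕ}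

theorem shift_recursion_eq_zero (hπ0 : π 0 = 0) (ha0 : ∀ m, a 0 m = π m)
    (has : ∀ k m, a (k + 1) m = ∑ i ∈ Finset.Icc 1 d, c i * a k (m - i)) {k m : ℕ} (h : m ≤ k) :
    a k m = 0 := by
  induction k generalizing m with
  | zero => rw [ha0, Nat.le_zero.1 h, hπ0]
  | succ k ih =>
    rw [has]
    refine Finset.sum_eq_zero fun i hi => ?_
    rw [Finset.mem_Icc] at hi
    rw [ih (by lia), mul_zero]

/-- The alternating sum `ℓ_m` of a sequence obtained from `π` by iterating the shift operator
`∑ c_i T^i` satisfies `ℓ_m + ∑ c_i ℓ_{m-i} = π_m`. -/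
theorem sum_range_shift_recursion (hπ0 : π 0 = 0) (ha0 : ∀ m, a 0 m = π m)
    (has : ∀ k m, a (k + 1) m = ∑ i ∈ Finset.Icc 1 d, c i * a k (m - i)) (m : ℕ) :
    ∑ k ∈ Finset.range m, (-1) ^ k * a k m +
      ∑ i ∈ Finset.Icc 1 d, c i * ∑ k ∈ Finset.range (m - i), (-1) ^ k * a k (m - i) = π m := by
  have hext : ∀ {M N : ℕ}, M ≤ N →
      ∑ k ∈ Finset.range M, (-1) ^ k * a k M = ∑ k ∈ Finset.range N, (-1) ^ k * a k M := by
    intro M N hMN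
    refine Finset.sum_subset (Finset.range_mono hMN) fun k _ hk => ?_
    rw [shift_recursion_eq_zero hπ0 ha0 has (by simpa using hk), mul_zero]
  have hinner : ∑ i ∈ Finset.Icc 1 d, c i * ∑ k ∈ Finset.range (m - i), (-1) ^ k * a k (m - i) =
      ∑ k ∈ Finset.range m, (-1) ^ k * a (k + 1) m := by
    simp_rw [has, Finset.mul_sum]
    rw [Finset.sum_comm]
    refine Finset.sum_congr rfl fun i _ => ?_
    rw [← Finset.mul_sum, hext (Nat.sub_le m i), Finset.mul_sum]
    exact Finset.sum_congr rfl fun k _ => by ring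
  rw [hinner, hext m.le_succ, Finset.sum_range_succ', ha0, add_right_comm, ← Finset.sum_add_distrib]
  simp [pow_succ]

end Recursion

/-- The series `ℓ_m = ∑_k (−1)^k g_k(π_m)` converges in `ℚ_p(π_m)`, and with
`ε = b_0·α_{p−1}/(p·(b_0+⋯+b_d))` one has, for `0 ≤ i < d`, `n − d ≥ 1`, `n − d − i ≥ 0`,
`∑_{s=0}^{d} p^s·b_s·Tr_{ℚ_p(π_{n−s})/ℚ_p(π_{n−d})}(ε + ℓ_{n−s−i}) = 0`. -/
theorem trace_relation_of_logarithm
    {p : ℕ} [Fact p.Prime]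
    -- `K` is a fixed algebraic closure of `ℚ_p` with the unique extension of the p-adic norm
    {K : Type} [NormedField K] [Algebra ℚ_[p] K] [IsAlgClosure ℚ_[p] K]
    (hnorm : ∀ x : ℚ_[p], ‖algebraMap ℚ_[p] K x‖ = ‖x‖)
    -- the polynomial f(X) = X^p + α_{p-1} X^{p-1} + ⋯ + α_1 X, with α_i ∈ pℤ_p, v_p(α_1) = 1
    (α : ℕ → ℚ_[p])
    (hα : ∀ i, 1 ≤ i → i ≤ p - 1 → ‖α i‖ ≤ (p : ℝ)⁻¹)
    (hα1 : ‖α 1‖ = (p : ℝ)⁻¹)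
    (f : ℚ_[p][X])
    (hf : f = X ^ p + ∑ i ∈ Finset.Icc 1 (p - 1), C (α i) * X ^ i)
    -- the coefficients b_0, …, b_d
    (d : ℕ) (hd : 1 ≤ d) (b : ℕ → ℚ_[p])
    (hbd : b d = 1) (hbp : ∀ i < d, ‖b i‖ ≤ (p : ℝ)⁻¹) (hb0 : b 0 ≠ 0)
    (hdvd : ∀ i, 1 ≤ i → i ≤ d → ‖(p : ℚ_[p]) ^ i * b i‖ ≤ ‖(p : ℚ_[p]) * b 0‖)
    -- f^{(i)}: the i-fold composite of f
    (fc : ℕ → ℚ_[p][X]) (hfc0 : fc 0 = X) (hfcs : ∀ i, fc (i + 1) = (fc i).comp f)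
    -- the polynomials g_k
    (g : ℕ → ℚ_[p][X]) (hg0 : g 0 = X)
    (hgs : ∀ k, g (k + 1) = ∑ i ∈ Finset.Icc 1 d, C (b i / b 0) * (g k).comp (fc i))
    -- the tower π_0 = 0, f(π_n) = π_{n−1}, π_n ≠ 0 for n ≥ 1
    (π : ℕ → K) (hπ0 : π 0 = 0)
    (hπ : ∀ n : ℕ, Polynomial.aeval (π (n + 1)) f = π n)
    (hπne : ∀ n : ℕ, π (n + 1) ≠ 0)
    -- the constant term ε = (b_0·α_{p−1})/(p·(b_0 + b_1 + ⋯ + b_d))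
    (ε : ℚ_[p]) (hε : ε = (b 0 * α (p - 1)) / ((p : ℚ_[p]) * ∑ s ∈ Finset.range (d + 1), b s)) :
    ∃ ℓ : ℕ → K,
      (∀ m : ℕ,
        HasSum (fun k => (-1 : K) ^ k * Polynomial.aeval (π m) (g k)) (ℓ m) ∧
        ℓ m ∈ IntermediateField.adjoin ℚ_[p] {π m}) ∧
      (∀ n i : ℕ, i < d → d + 1 ≤ n → d + i ≤ n →
        (∀ s ≤ d,
          IntermediateField.adjoin ℚ_[p] {π (n - d)} ≤ IntermediateField.adjoin ℚ_[p] {π (n - s)} ∧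
          algebraMap ℚ_[p] K ε + ℓ (n - s - i) ∈ IntermediateField.adjoin ℚ_[p] {π (n - s)}) ∧
        ∑ s ∈ Finset.range (d + 1),
          algebraMap ℚ_[p] K ((p : ℚ_[p]) ^ s * b s) *
            relTrace (IntermediateField.adjoin ℚ_[p] {π (n - d)})
              (IntermediateField.adjoin ℚ_[p] {π (n - s)})
              (algebraMap ℚ_[p] K ε + ℓ (n - s - i)) = 0) := by
  have hp : 2 ≤ p := (Fact.out : p.Prime).two_le
  have hpℝ : ((p : ℝ)⁻¹) < 1 := inv_lt_one_of_one_lt₀ (by exact_mod_cast (by lia : 1 < p))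
  have hp0 : (p : ℚ_[p]) ≠ 0 := by exact_mod_cast (by lia : p ≠ 0)
  have hπ1 : π 1 ≠ 0 := hπne 0
  have hfc : ∀ i m, aeval (π m) (fc i) = π (m - i) := by
    have hf0 : aeval (0 : K) f = 0 := by
      rw [hf, map_add, map_pow, aeval_X, zero_pow (by lia), zero_add, map_sum]
      refine Finset.sum_eq_zero fun i hi => ?_
      rw [Finset.mem_Icc] at hi
      simp [show i ≠ 0 by lia]
    intro i
    induction i with
    | zero => simp [hfc0]
    | succ i ih =>
      intro m
      rw [hfcs, aeval_comp]
      cases m with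
      | zero => rw [hπ0, hf0, ← hπ0, ih, Nat.zero_sub, Nat.zero_sub]
      | succ m => rw [hπ, ih, Nat.add_sub_add_right]
  set a : ℕ → ℕ → K := fun k m => aeval (π m) (g k) with ha
  have ha0 : ∀ m, a 0 m = π m := fun m => by simp [ha, hg0]
  have has : ∀ k m, a (k + 1) m =
      ∑ i ∈ Finset.Icc 1 d, algebraMap ℚ_[p] K (b i / b 0) * a k (m - i) := by
    intro k m
    simp only [ha, hgs, map_sum, map_mul, aeval_C, aeval_comp, hfc]
  set ℓ : ℕ → K := fun m => ∑ k ∈ Finset.range m, (-1) ^ k * a k m with hℓ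
  have hmemℓ : ∀ {m n}, m ≤ n → ℓ m ∈ IntermediateField.adjoin ℚ_[p] {π n} := by
    intro m n hmn
    refine adjoin_tower_mono hπ hmn (sum_mem fun k _ => mul_mem ?_ ?_)
    · exact pow_mem (neg_mem (one_mem _)) _
    · exact IntermediateField.algebra_adjoin_le_adjoin _ _ (aeval_mem_adjoin_singleton _ _)
  have hmem : ∀ {m n}, m ≤ n →
      algebraMap ℚ_[p] K ε + ℓ m ∈ IntermediateField.adjoin ℚ_[p] {π n} := fun hmn =>
    add_mem (IntermediateField.algebraMap_mem _ _) (hmemℓ hmn)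
  have hfun : ∀ m, ∑ s ∈ Finset.range (d + 1), algebraMap ℚ_[p] K (b s) * ℓ (m - s) =
      algebraMap ℚ_[p] K (b 0) * π m := by
    intro m
    rw [← sum_range_shift_recursion hπ0 ha0 has m, mul_add, Finset.mul_sum (Finset.Icc 1 d),
      Finset.range_eq_Ico, Finset.sum_eq_sum_Ico_succ_bot (by lia), Nat.sub_zero]
    congr 1
    refine Finset.sum_congr rfl fun i _ => ?_
    rw [← mul_assoc, ← map_mul, mul_div_cancel₀ _ hb0]
  refine ⟨ℓ, fun m => ⟨?_, hmemℓ le_rfl⟩, fun n i hid hdn hin => ⟨fun s hs =>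
    ⟨adjoin_tower_mono hπ (by lia), hmem (by lia)⟩, ?_⟩⟩
  · refine hasSum_sum_of_ne_finset_zero fun k hk => ?_
    have := shift_recursion_eq_zero hπ0 ha0 has (k := k) (m := m) (by simpa using hk)
    rw [show aeval (π m) (g k) = 0 from this, mul_zero]
  · have hk : 1 ≤ n - d := by lia
    have hbsum : ∑ s ∈ Finset.range (d + 1), b s ≠ 0 := by
      rw [Finset.sum_range_succ, hbd]
      intro h
      have hle : ‖∑ s ∈ Finset.range d, b s‖ ≤ (p : ℝ)⁻¹ :=
        IsUltrametricDist.norm_sum_le_of_forall_le_of_nonneg (by positivity) fun s hs =>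
          hbp s (Finset.mem_range.1 hs)
      rw [eq_neg_of_add_eq_zero_left h, norm_neg, norm_one] at hle
      exact hpℝ.not_ge hle
    have hterm : ∀ s ∈ Finset.range (d + 1), algebraMap ℚ_[p] K ((p : ℚ_[p]) ^ s * b s) *
        relTrace (IntermediateField.adjoin ℚ_[p] {π (n - d)})
          (IntermediateField.adjoin ℚ_[p] {π (n - s)}) (algebraMap ℚ_[p] K ε + ℓ (n - s - i)) =
        relTrace (IntermediateField.adjoin ℚ_[p] {π (n - d)})
          (IntermediateField.adjoin ℚ_[p] {π n})
          (algebraMap ℚ_[p] K (b s) * (algebraMap ℚ_[p] K ε + ℓ (n - s - i))) := by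
      intro s hs
      rw [Finset.mem_range] at hs
      rw [relTrace_algebraMap_mul (adjoin_tower_mono hπ (by lia)) _ (hmem (by lia)),
        relTrace_tower_of_mem_of_le hα hα1 hf hπ0 hπ hπ1 hk (m := n - s) (n := n)
          (by lia) (Nat.sub_le n s) (hmem (by lia)), show n - (n - s) = s by lia, map_mul,
        map_pow, map_natCast]
      ring
    have hsum : ∑ s ∈ Finset.range (d + 1),
        algebraMap ℚ_[p] K (b s) * (algebraMap ℚ_[p] K ε + ℓ (n - s - i)) =
        algebraMap ℚ_[p] K ((∑ s ∈ Finset.range (d + 1), b s) * ε) +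
          algebraMap ℚ_[p] K (b 0) * π (n - i) := by
      rw [← hfun, map_mul, map_sum, Finset.sum_mul, ← Finset.sum_add_distrib]
      refine Finset.sum_congr rfl fun s _ => ?_
      rw [mul_add, Nat.sub_right_comm]
    have hle := adjoin_tower_mono hπ (Nat.sub_le n d)
    have hπmem : π (n - i) ∈ IntermediateField.adjoin ℚ_[p] {π n} :=
      adjoin_tower_mono hπ (Nat.sub_le n i) (IntermediateField.mem_adjoin_simple_self _ _)
    rw [Finset.sum_congr rfl hterm, ← relTrace_sum hle _ fun s _ =>
      mul_mem (IntermediateField.algebraMap_mem _ _) (hmem (by lia)), hsum,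
      relTrace_add hle (IntermediateField.algebraMap_mem _ _)
        (mul_mem (IntermediateField.algebraMap_mem _ _) hπmem),
      relTrace_algebraMap_mul hle _ hπmem,
      relTrace_tower_gen hα hα1 hf hπ0 hπ hπ1 hk (by lia) (Nat.sub_le n i),
      relTrace_tower_of_mem hα hα1 hf hπ0 hπ hπ1 hk (Nat.sub_le n d)
        (IntermediateField.algebraMap_mem _ _), show n - 1 - (n - d) = d - 1 by lia,
      show n - (n - d) = d - 1 + 1 by lia, hε, ← map_natCast (algebraMap ℚ_[p] K) p, ← map_pow,
      ← map_pow, ← map_mul, ← map_mul, ← map_neg, ← map_mul, ← map_add]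
    convert map_zero (algebraMap ℚ_[p] K)
    field_simp
    ring
end

section
/- Every root α, in a fixed algebraic closure of ℚ_p, of the characteristic polynomial of F satisfies 0 ≤ v_p(α) ≤ 1, i.e. p^{−1} ≤ ‖α‖ ≤ 1. -/
open Polynomial

/-- In a nonarchimedean normed field extension, a root of a monic polynomial whose coefficients
have norm at most one has norm at most one. -/
theorem norm_le_one_of_aeval_eq_zero {k K : Type*} [NormedField k] [NormedField K]
    [NormedAlgebra k K] [IsUltrametricDist K] {q : k[X]} (hq : q.Monic)
    (hcoeff : ∀ n, ‖q.coeff n‖ ≤ 1) {x : K} (hx : aeval x q = 0) : ‖x‖ ≤ 1 := by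
  have hna : IsNonarchimedean (NormedAlgebra.toMulAlgebraNorm k K).toAlgebraNorm :=
    IsUltrametricDist.isNonarchimedean_norm
  exact (norm_root_le_spectralValue
    (MulRingNorm.isPowMul (NormedAlgebra.toMulAlgebraNorm k K).toMulRingNorm) hna hq hx).trans
    ((spectralValue_le_one_iff hq).2 hcoeff)

/-- If `g ∘ f` is multiplication by a scalar `c`, nonzero in the field `K`, then every root `α`
in `K` of the characteristic polynomial of `f` has a companion root `β` of the characteristic
polynomial of `g`, with `α * β = c`. -/
theorem LinearMap.exists_aeval_charpoly_eq_zero_of_comp_eq_smul {R K M : Type*} [CommRing R]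
    [Field K] [Algebra R K] [AddCommGroup M] [Module R M] [Module.Finite R M] [Module.Free R M]
    {f g : M →ₗ[R] M} {c : R} (hgf : g ∘ₗ f = c • LinearMap.id) (hc : algebraMap R K c ≠ 0)
    {α : K} (hα : aeval α f.charpoly = 0) :
    ∃ β : K, α * β = algebraMap R K c ∧ aeval β g.charpoly = 0 := by
  have hroot : Module.End.HasEigenvalue (f.baseChange K) α := by
    rw [Module.End.hasEigenvalue_iff_isRoot_charpoly, LinearMap.charpoly_baseChange, IsRoot.def,
      eval_map_algebraMap, hα]
  obtain ⟨v, hv⟩ := hroot.exists_hasEigenvector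
  have hcomp : g.baseChange K (f.baseChange K v) = algebraMap R K c • v := by
    rw [← LinearMap.comp_apply, ← LinearMap.baseChange_comp, hgf, LinearMap.baseChange_smul,
      LinearMap.baseChange_id, LinearMap.smul_apply, LinearMap.id_apply, algebraMap_smul]
  rw [hv.apply_eq_smul, map_smul] at hcomp
  have hα0 : α ≠ 0 := by
    rintro rfl
    rw [zero_smul] at hcomp
    exact smul_ne_zero hc hv.2 hcomp.symm
  refine ⟨α⁻¹ * algebraMap R K c, mul_inv_cancel_left₀ hα0 _, ?_⟩
  have hβ : Module.End.HasEigenvalue (g.baseChange K) (α⁻¹ * algebraMap R K c) := by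
    refine Module.End.hasEigenvalue_of_hasEigenvector
      ⟨Module.End.mem_eigenspace_iff.2 ?_, hv.2⟩
    rw [mul_smul, ← hcomp, inv_smul_smul₀ hα0]
  rwa [Module.End.hasEigenvalue_iff_isRoot_charpoly, LinearMap.charpoly_baseChange, IsRoot.def,
    eval_map_algebraMap] at hβ

/-- Every root `α` of the characteristic polynomial of the Frobenius `F` of a
torsion-free Dieudonné module satisfies `0 ≤ v_p(α) ≤ 1`, i.e. `p⁻¹ ≤ ‖α‖ ≤ 1`. -/
theorem frobenius_charpoly_root_norm_bounds
    {p : ℕ} [Fact p.Prime]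
    -- `K` is a fixed algebraic closure of `ℚ_p` with the unique extension of the p-adic norm
    {K : Type} [NormedField K] [Algebra ℚ_[p] K] [IsAlgClosure ℚ_[p] K]
    (hnorm : ∀ x : ℚ_[p], ‖algebraMap ℚ_[p] K x‖ = ‖x‖)
    -- `M` is a finite free `ℤ_p`-module with `F ∘ V = V ∘ F = p • id`
    {M : Type} [AddCommGroup M] [Module ℤ_[p] M]
    [Module.Finite ℤ_[p] M] [Module.Free ℤ_[p] M]
    (F V : M →ₗ[ℤ_[p]] M)
    (hFV : F ∘ₗ V = (p : ℤ_[p]) • LinearMap.id)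
    (hVF : V ∘ₗ F = (p : ℤ_[p]) • LinearMap.id) :
    ∀ α : K,
      Polynomial.aeval α ((LinearMap.charpoly F).map (algebraMap ℤ_[p] ℚ_[p])) = 0 →
      (p : ℝ)⁻¹ ≤ ‖α‖ ∧ ‖α‖ ≤ 1 := by
  let _ : NormedAlgebra ℚ_[p] K :=
    { ‹Algebra ℚ_[p] K› with
      norm_smul_le := fun r x => by rw [Algebra.smul_def, norm_mul, hnorm] }
  have : IsUltrametricDist K :=
    IsUltrametricDist.isUltrametricDist_of_forall_norm_natCast_le_one fun n => by
      rw [← map_natCast (algebraMap ℚ_[p] K), hnorm]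
      exact IsUltrametricDist.norm_natCast_le_one _ n
  let _ : Algebra ℤ_[p] K := ((algebraMap ℚ_[p] K).comp (algebraMap ℤ_[p] ℚ_[p])).toAlgebra
  have : IsScalarTower ℤ_[p] ℚ_[p] K := IsScalarTower.of_algebraMap_eq fun _ => rfl
  have hroot (f : M →ₗ[ℤ_[p]] M) {x : K} (hx : aeval x f.charpoly = 0) : ‖x‖ ≤ 1 := by
    rw [← aeval_map_algebraMap ℚ_[p]] at hx
    refine norm_le_one_of_aeval_eq_zero (f.charpoly_monic.map _) (fun n => ?_) hx
    rw [coeff_map]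
    exact PadicInt.norm_le_one _
  have hp : ‖algebraMap ℤ_[p] K p‖ = (p : ℝ)⁻¹ := by
    rw [map_natCast, ← map_natCast (algebraMap ℚ_[p] K), hnorm, Padic.norm_p]
  have hp0 : algebraMap ℤ_[p] K p ≠ 0 := by
    rw [← norm_ne_zero_iff, hp]
    exact inv_ne_zero (Nat.cast_ne_zero.2 (Fact.out : p.Prime).ne_zero)
  intro α hα
  rw [aeval_map_algebraMap] at hα
  obtain ⟨β, hαβ, hβ⟩ := LinearMap.exists_aeval_charpoly_eq_zero_of_comp_eq_smul hVF hp0 hα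
  refine ⟨?_, hroot F hα⟩
  rw [← hp, ← hαβ, norm_mul]
  exact mul_le_of_le_one_right (norm_nonneg _) (hroot V hβ)
end

section
/- Let f ∈ ℤ_p[X] be a monic polynomial such that every root α of f in a fixed algebraic closure of ℚ_p satisfies v_p(α) ≤ 1. Then there exist monic polynomials f_1, f_2 ∈ ℤ_p[X] with f = f_1·f_2 such that every root of f_1 in the algebraic closure has p-adic valuation exactly 1 and every root of f_2 has p-adic valuation strictly less than 1. -/
open Polynomial

/-- A monic polynomial over an integrally closed domain splits into two monic factors according to
any property of its roots that depends only on their minimal polynomials. -/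
theorem Polynomial.Monic.exists_mul_eq_of_minpoly_invariant
    {R F K : Type*} [CommRing R] [IsDomain R] [IsIntegrallyClosed R] [Field F] [Algebra R F]
    [IsFractionRing R F] [Field K] [Algebra F K] [IsAlgClosed K] (P : K → Prop)
    (hP : ∀ α β : K, minpoly F α = minpoly F β → P α → P β) {f : R[X]} (hf : f.Monic) :
    ∃ f₁ f₂ : R[X], f₁.Monic ∧ f₂.Monic ∧ f = f₁ * f₂ ∧
      (∀ α : K, aeval α (f₁.map (algebraMap R F)) = 0 → P α) ∧
      (∀ α : K, aeval α (f₂.map (algebraMap R F)) = 0 → ¬ P α) := by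
  induction hn : f.natDegree using Nat.strong_induction_on generalizing f with
  | _ n ih =>
    subst hn
    by_cases hdeg : f.natDegree = 0
    · obtain rfl := hf.natDegree_eq_zero.mp hdeg
      exact ⟨1, 1, monic_one, monic_one, (mul_one 1).symm, by simp, by simp⟩
    · have hfF : (f.map (algebraMap R F)).Monic := hf.map _
      obtain ⟨α, hα⟩ : ∃ α : K, aeval α (f.map (algebraMap R F)) = 0 :=
        IsAlgClosed.exists_aeval_eq_zero K _ fun h => hdeg <| by
          rw [← hf.natDegree_map (algebraMap R F)]
          exact natDegree_eq_of_degree_eq_some h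
      have hint : IsIntegral F α := ⟨_, hfF, hα⟩
      have hdvd := minpoly.dvd F α hα
      obtain ⟨m, hm⟩ := IsIntegrallyClosed.eq_map_mul_C_of_dvd F hf hdvd
      rw [(minpoly.monic hint).leadingCoeff, C_1, mul_one] at hm
      have hinj := IsFractionRing.injective R F
      have hmm : m.Monic := monic_of_injective hinj (hm ▸ minpoly.monic hint)
      have hroot (β : K) (hβ : aeval β (m.map (algebraMap R F)) = 0) :
          minpoly F α = minpoly F β :=
        minpoly.eq_of_irreducible_of_monic (minpoly.irreducible hint) (hm ▸ hβ)
          (minpoly.monic hint)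
      obtain ⟨g, rfl⟩ := (map_dvd_map _ hinj hmm).mp (hm ▸ hdvd)
      have hg : g.Monic := hmm.of_mul_monic_left hf
      have hmpos : 0 < m.natDegree := by
        rw [← hmm.natDegree_map (algebraMap R F), hm]
        exact minpoly.natDegree_pos hint
      obtain ⟨g₁, g₂, hg₁, hg₂, rfl, h₁, h₂⟩ :=
        ih g.natDegree (by rw [hmm.natDegree_mul hg]; lia) hg rfl
      by_cases hPα : P α
      · refine ⟨m * g₁, g₂, hmm.mul hg₁, hg₂, by ring, fun β hβ => ?_, h₂⟩
        rw [Polynomial.map_mul, map_mul, mul_eq_zero] at hβ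
        exact hβ.elim (fun h => hP α β (hroot β h) hPα) (h₁ β)
      · refine ⟨g₁, m * g₂, hg₁, hmm.mul hg₂, by ring, h₁, fun β hβ => ?_⟩
        rw [Polynomial.map_mul, map_mul, mul_eq_zero] at hβ
        exact hβ.elim (fun h hPβ => hPα (hP β α (hroot β h).symm hPβ)) (h₂ β)

/-- A monic polynomial over `ℤ_p` whose roots all have `v_p ≤ 1` factors as a
product of monic polynomials `f₁·f₂` over `ℤ_p`, where all roots of `f₁` have `v_p` exactly `1`
(`‖·‖ = p⁻¹`) and all roots of `f₂` have `v_p < 1` (`‖·‖ > p⁻¹`). -/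
theorem monic_factorization_by_root_valuation
    {p : ℕ} [Fact p.Prime]
    -- `K` is a fixed algebraic closure of `ℚ_p` with the unique extension of the p-adic norm
    {K : Type} [NormedField K] [Algebra ℚ_[p] K] [IsAlgClosure ℚ_[p] K]
    (hnorm : ∀ x : ℚ_[p], ‖algebraMap ℚ_[p] K x‖ = ‖x‖)
    (f : ℤ_[p][X]) (hf : f.Monic)
    (hroots : ∀ α : K, Polynomial.aeval α (f.map (algebraMap ℤ_[p] ℚ_[p])) = 0 →
      (p : ℝ)⁻¹ ≤ ‖α‖) :
    ∃ f₁ f₂ : ℤ_[p][X], f₁.Monic ∧ f₂.Monic ∧ f = f₁ * f₂ ∧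
      (∀ α : K, Polynomial.aeval α (f₁.map (algebraMap ℤ_[p] ℚ_[p])) = 0 → ‖α‖ = (p : ℝ)⁻¹) ∧
      (∀ α : K, Polynomial.aeval α (f₂.map (algebraMap ℤ_[p] ℚ_[p])) = 0 → (p : ℝ)⁻¹ < ‖α‖) := by
  have : IsAlgClosed K := IsAlgClosure.isAlgClosed ℚ_[p]
  have : Algebra.IsAlgebraic ℚ_[p] K := IsAlgClosure.isAlgebraic
  let _ : NormedAlgebra ℚ_[p] K :=
    { norm_smul_le := fun r x => by rw [Algebra.smul_def, norm_mul, hnorm] }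
  have hconj (α β : K) (h : minpoly ℚ_[p] α = minpoly ℚ_[p] β) (hα : ‖α‖ = (p : ℝ)⁻¹) :
      ‖β‖ = (p : ℝ)⁻¹ := by
    rw [NormedAlgebra.norm_eq_spectralNorm ℚ_[p], spectralNorm] at hα ⊢
    rwa [← h]
  obtain ⟨f₁, f₂, hf₁, hf₂, rfl, h₁, h₂⟩ :=
    hf.exists_mul_eq_of_minpoly_invariant (F := ℚ_[p]) (fun α : K => ‖α‖ = (p : ℝ)⁻¹) hconj
  refine ⟨f₁, f₂, hf₁, hf₂, rfl, h₁, fun α hα => lt_of_le_of_ne (hroots α ?_) (Ne.symm (h₂ α hα))⟩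
  rw [Polynomial.map_mul, map_mul, hα, mul_zero]
end

section
/- Let L be a finite field extension of ℚ_p, equipped with the unique absolute value ‖·‖ extending the p-adic absolute value of ℚ_p. For every x ∈ L with ‖x‖ < 1: (i) g_k(x) → 0 in L as k → ∞, so that ℓ(x) := Σ_{k=0}^{∞} (−1)^k·g_k(x) converges in L; and (ii) the functional equation ℓ(x) + Σ_{i=1}^{d} (b_i/b_0)·ℓ(f^{(i)}(x)) = x holds (each f^{(i)}(x) again satisfies ‖f^{(i)}(x)‖ < 1). -/
open Polynomial Filter

/-- If a self-map `F` of the open unit ball satisfies `‖F y‖ ≤ ‖y‖ * max ‖y‖ q`, then its orbits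
decay at least like `q ^ n`. -/
lemma exists_norm_iterate_le {E : Type*} [SeminormedAddGroup E] {F : E → E} {q : ℝ}
    (hq0 : 0 < q) (hq1 : q < 1) (hF : ∀ y, ‖y‖ < 1 → ‖F y‖ ≤ ‖y‖ * max ‖y‖ q)
    {x : E} (hx : ‖x‖ < 1) : ∃ K : ℝ, ∀ n, ‖F^[n] x‖ ≤ K * q ^ n := by
  set ρ := max ‖x‖ q with hρ
  have hρ0 : 0 ≤ ρ := le_max_of_le_right hq0.le
  have hρ1 : ρ < 1 := max_lt hx hq1
  have hdecay : ∀ n, ‖F^[n] x‖ ≤ ‖x‖ * ρ ^ n := by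
    intro n
    induction n with
    | zero => simp
    | succ n ih =>
      have hle : ‖F^[n] x‖ ≤ ‖x‖ :=
        ih.trans (mul_le_of_le_one_right (norm_nonneg _) (pow_le_one₀ hρ0 hρ1.le))
      rw [Function.iterate_succ_apply', pow_succ, ← mul_assoc]
      exact (hF _ (hle.trans_lt hx)).trans
        (mul_le_mul ih (max_le_max_right q hle) (le_max_of_le_right hq0.le) (by positivity))
  have hlt : ∀ n, ‖F^[n] x‖ < 1 := fun n =>
    ((hdecay n).trans (mul_le_of_le_one_right (norm_nonneg _) (pow_le_one₀ hρ0 hρ1.le))).trans_lt hx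
  obtain ⟨N, hN⟩ := exists_pow_lt_of_lt_one hq0 hρ1
  refine ⟨(q ^ N)⁻¹, fun n => ?_⟩
  have hsmall : ∀ n ≤ N, ‖F^[n] x‖ ≤ (q ^ N)⁻¹ * q ^ n := by
    intro n hn
    refine (hlt n).le.trans ?_
    rw [inv_mul_eq_div, one_le_div (by positivity)]
    exact pow_le_pow_of_le_one hq0.le hq1.le hn
  induction n with
  | zero => exact hsmall 0 (Nat.zero_le _)
  | succ n ih =>
    rcases Nat.lt_or_ge n N with h | h
    · exact hsmall _ h
    · have hq : ‖F^[n] x‖ ≤ q :=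
        calc ‖F^[n] x‖ ≤ ‖x‖ * ρ ^ n := hdecay n
          _ ≤ ρ ^ n := mul_le_of_le_one_left (by positivity) hx.le
          _ ≤ ρ ^ N := pow_le_pow_of_le_one hρ0 hρ1.le h
          _ ≤ q := hN.le
      have hstep := hF _ (hlt n)
      rw [max_eq_right hq] at hstep
      rw [Function.iterate_succ_apply', pow_succ, ← mul_assoc]
      exact hstep.trans (mul_le_mul_of_nonneg_right ih hq0.le)

/-- For `x` in a finite extension `L/ℚ_p` with `‖x‖ < 1`, the series
`ℓ(x) = ∑_k (−1)^k g_k(x)` converges in `L`, each `f^{(i)}(x)` again has norm `< 1`, and the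
functional equation `ℓ(x) + ∑_{i=1}^{d} (b_i/b_0)·ℓ(f^{(i)}(x)) = x` holds. -/
theorem logarithm_functional_equation
    {p : ℕ} [Fact p.Prime]
    -- `L` is a finite extension of `ℚ_p` with the unique extension of the p-adic norm
    {L : Type} [NormedField L] [Algebra ℚ_[p] L] [FiniteDimensional ℚ_[p] L]
    (hnorm : ∀ x : ℚ_[p], ‖algebraMap ℚ_[p] L x‖ = ‖x‖)
    -- the polynomial f(X) = X^p + α_{p-1} X^{p-1} + ⋯ + α_1 X, with α_i ∈ pℤ_p, v_p(α_1) = 1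
    (α : ℕ → ℚ_[p])
    (hα : ∀ i, 1 ≤ i → i ≤ p - 1 → ‖α i‖ ≤ (p : ℝ)⁻¹)
    (hα1 : ‖α 1‖ = (p : ℝ)⁻¹)
    (f : ℚ_[p][X])
    (hf : f = X ^ p + ∑ i ∈ Finset.Icc 1 (p - 1), C (α i) * X ^ i)
    -- the coefficients b_0, …, b_d
    (d : ℕ) (hd : 1 ≤ d) (b : ℕ → ℚ_[p])
    (hbd : b d = 1) (hbp : ∀ i < d, ‖b i‖ ≤ (p : ℝ)⁻¹) (hb0 : b 0 ≠ 0)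
    (hdvd : ∀ i, 1 ≤ i → i ≤ d → ‖(p : ℚ_[p]) ^ i * b i‖ ≤ ‖(p : ℚ_[p]) * b 0‖)
    -- f^{(i)}: the i-fold composite of f
    (fc : ℕ → ℚ_[p][X]) (hfc0 : fc 0 = X) (hfcs : ∀ i, fc (i + 1) = (fc i).comp f)
    -- the polynomials g_k
    (g : ℕ → ℚ_[p][X]) (hg0 : g 0 = X)
    (hgs : ∀ k, g (k + 1) = ∑ i ∈ Finset.Icc 1 d, C (b i / b 0) * (g k).comp (fc i)) :
    ∀ x : L, ‖x‖ < 1 →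
      -- (i) convergence of ℓ(x)
      Tendsto (fun k => Polynomial.aeval x (g k)) atTop (nhds 0) ∧
      (∃ S : L, HasSum (fun k => (-1 : L) ^ k * Polynomial.aeval x (g k)) S) ∧
      -- each f^{(i)}(x) again has norm < 1
      (∀ i, ‖Polynomial.aeval x (fc i)‖ < 1) ∧
      -- (ii) the functional equation ℓ(x) + ∑_{i=1}^{d} (b_i/b_0)·ℓ(f^{(i)}(x)) = x
      (∑' k, (-1 : L) ^ k * Polynomial.aeval x (g k)) +
        ∑ i ∈ Finset.Icc 1 d, algebraMap ℚ_[p] L (b i / b 0) *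
          ∑' k, (-1 : L) ^ k * Polynomial.aeval (Polynomial.aeval x (fc i)) (g k) = x := by
  have hp := Fact.out (p := p.Prime)
  set q : ℝ := (p : ℝ)⁻¹ with hq
  have hp1 : (1 : ℝ) < p := by exact_mod_cast hp.one_lt
  have hq0 : 0 < q := by positivity
  have hq1 : q < 1 := inv_lt_one_of_one_lt₀ hp1
  let _ : NormedAlgebra ℚ_[p] L :=
    { norm_smul_le := fun r x => by rw [Algebra.smul_def, norm_mul, hnorm] }
  have _ : CompleteSpace L := FiniteDimensional.complete ℚ_[p] L
  have _ : IsUltrametricDist L := IsUltrametricDist.of_normedAlgebra ℚ_[p]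
  let F : L → L := fun y => aeval y f
  have hF : ∀ y : L, ‖y‖ < 1 → ‖F y‖ ≤ ‖y‖ * max ‖y‖ q := by
    intro y hy
    have hFy : F y = y ^ p + ∑ i ∈ Finset.Icc 1 (p - 1), algebraMap ℚ_[p] L (α i) * y ^ i := by
      simp [F, hf]
    rw [hFy]
    refine (IsUltrametricDist.norm_add_le_max _ _).trans (max_le ?_ ?_)
    · calc ‖y ^ p‖ = ‖y‖ ^ p := norm_pow _ _
        _ ≤ ‖y‖ ^ 2 := pow_le_pow_of_le_one (norm_nonneg _) hy.le hp.two_le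
        _ = ‖y‖ * ‖y‖ := sq _
        _ ≤ ‖y‖ * max ‖y‖ q := by gcongr; exact le_max_left _ _
    · refine IsUltrametricDist.norm_sum_le_of_forall_le_of_nonneg (by positivity) fun i hi => ?_
      obtain ⟨h1, h2⟩ := Finset.mem_Icc.mp hi
      calc ‖algebraMap ℚ_[p] L (α i) * y ^ i‖ = ‖α i‖ * ‖y‖ ^ i := by
            rw [norm_mul, hnorm, norm_pow]
        _ ≤ q * ‖y‖ := by
            gcongr
            · exact hα i h1 h2
            · exact pow_le_of_le_one (norm_nonneg _) hy.le (by omega)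
        _ = ‖y‖ * q := mul_comm _ _
        _ ≤ ‖y‖ * max ‖y‖ q := by gcongr; exact le_max_right _ _
  have hfc : ∀ i (y : L), aeval y (fc i) = F^[i] y := by
    intro i
    induction i with
    | zero => intro y; simp [hfc0]
    | succ i ih => intro y; rw [hfcs, aeval_comp, ih, Function.iterate_succ_apply]
  have hgrec : ∀ k (y : L), aeval y (g (k + 1)) =
      ∑ i ∈ Finset.Icc 1 d, algebraMap ℚ_[p] L (b i / b 0) * aeval (F^[i] y) (g k) := by
    intro k y
    simp [hgs, map_sum, aeval_comp, hfc]
  have hcoef : ∀ i, 1 ≤ i → i ≤ d → ‖b i / b 0‖ * q ^ i ≤ q := by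
    intro i h1 h2
    have h := hdvd i h1 h2
    rw [norm_mul, norm_mul, norm_pow, Padic.norm_p] at h
    rw [norm_div, div_mul_eq_mul_div, div_le_iff₀ (norm_pos_iff.mpr hb0), mul_comm]
    exact h
  have hbound : ∀ k (K : ℝ) (y : L), (∀ n, ‖F^[n] y‖ ≤ K * q ^ n) →
      ‖aeval y (g k)‖ ≤ K * q ^ k := by
    intro k
    induction k with
    | zero => intro K y h; simpa [hg0] using h 0
    | succ k ih =>
      intro K y h
      have hK : 0 ≤ K := by simpa using (norm_nonneg _).trans (h 0)
      rw [hgrec]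
      refine IsUltrametricDist.norm_sum_le_of_forall_le_of_nonneg (by positivity) fun i hi => ?_
      obtain ⟨h1, h2⟩ := Finset.mem_Icc.mp hi
      have hshift : ‖aeval (F^[i] y) (g k)‖ ≤ K * q ^ i * q ^ k := by
        refine ih _ _ fun n => ?_
        rw [← Function.iterate_add_apply, mul_assoc, ← pow_add, add_comm i n]
        exact h _
      calc ‖algebraMap ℚ_[p] L (b i / b 0) * aeval (F^[i] y) (g k)‖
          ≤ ‖b i / b 0‖ * (K * q ^ i * q ^ k) := by
            rw [norm_mul, hnorm]
            gcongr
        _ = (‖b i / b 0‖ * q ^ i) * (K * q ^ k) := by ring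
        _ ≤ q * (K * q ^ k) := by gcongr; exact hcoef i h1 h2
        _ = K * q ^ (k + 1) := by ring
  have hsum : ∀ y : L, ‖y‖ < 1 → Summable fun k => (-1 : L) ^ k * aeval y (g k) := by
    intro y hy
    obtain ⟨K, hK⟩ := exists_norm_iterate_le hq0 hq1 hF hy
    refine Summable.of_norm_bounded ((summable_geometric_of_lt_one hq0.le hq1).mul_left K)
      fun k => ?_
    simpa using hbound k K y hK
  have hball : ∀ i (y : L), ‖y‖ < 1 → ‖F^[i] y‖ < 1 := by
    intro i
    induction i with
    | zero => intro y hy; simpa using hy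
    | succ i ih =>
      intro y hy
      rw [Function.iterate_succ_apply]
      exact ih _ ((hF y hy).trans_lt
        ((mul_le_of_le_one_right (norm_nonneg _) (max_le hy.le hq1.le)).trans_lt hy))
  intro x hx
  refine ⟨?_, hsum x hx, fun i => by rw [hfc]; exact hball i x hx, ?_⟩
  · simpa [tendsto_zero_iff_norm_tendsto_zero] using (hsum x hx).tendsto_atTop_zero
  · simp only [hfc]
    have hswap : ∑ i ∈ Finset.Icc 1 d, algebraMap ℚ_[p] L (b i / b 0) *
        ∑' k, (-1 : L) ^ k * aeval (F^[i] x) (g k) =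
        ∑' k, (-1 : L) ^ k * aeval x (g (k + 1)) := by
      simp only [← tsum_mul_left]
      rw [← Summable.tsum_finsetSum fun i _ => (hsum _ (hball i x hx)).mul_left _]
      refine tsum_congr fun k => ?_
      rw [hgrec, Finset.mul_sum]
      exact Finset.sum_congr rfl fun i _ => mul_left_comm _ _ _
    rw [hswap, (hsum x hx).tsum_eq_zero_add]
    simp [hg0, pow_succ, tsum_neg]
end

section
/- Assume π_0 = 0 and, for every n ≥ 1, π_n ≠ 0 and f(π_n) = π_{n−1}. Then for every n ≥ 1, the extension ℚ_p(π_n)/ℚ_p has degree (p−1)·p^{n−1}, and ‖π_n‖^{(p−1)·p^{n−1}} = p^{−1}; in particular ℚ_p(π_n)/ℚ_p is totally ramified and π_n is a uniformizer of ℚ_p(π_n). -/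
open Polynomial

set_option synthInstance.maxHeartbeats 1000000
set_option maxHeartbeats 1000000

section Ultrametric

variable {p : ℕ} [Fact p.Prime] {K : Type*} [NormedField K] [Algebra ℚ_[p] K]

/-- A norm extending the `p`-adic norm is ultrametric. -/
lemma isUltrametricDist_of_norm_algebraMap (hnorm : ∀ x : ℚ_[p], ‖algebraMap ℚ_[p] K x‖ = ‖x‖) :
    IsUltrametricDist K := by
  refine IsUltrametricDist.isUltrametricDist_of_forall_norm_natCast_le_one fun n => ?_
  rw [← map_natCast (algebraMap ℚ_[p] K), hnorm]
  exact_mod_cast Padic.norm_int_le_one (p := p) n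

/-- If `‖x‖ ^ N = p⁻¹`, then nonzero terms of the form `a * x ^ i` with `a ∈ ℚ_p` and `i < N`
have pairwise distinct norms. -/
lemma index_eq_of_norm_mul_pow_eq {r : ℝ} {N : ℕ} (hr : r ^ N = (p : ℝ)⁻¹)
    {a b : ℚ_[p]} (ha : a ≠ 0) (hb : b ≠ 0) {i j : ℕ} (hi : i < N) (hj : j < N)
    (h : ‖a‖ * r ^ i = ‖b‖ * r ^ j) : i = j := by
  have hp1 : (1 : ℝ) < p := mod_cast (Fact.out : p.Prime).one_lt
  have hp0 : (0 : ℝ) < p := by linarith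
  have key (c : ℚ_[p]) (hc : c ≠ 0) (k : ℕ) :
      (‖c‖ * r ^ k) ^ N = (p : ℝ) ^ (-(c.valuation * N + k)) := by
    rw [mul_pow, ← pow_mul, mul_comm k, pow_mul, hr, Padic.norm_eq_zpow_neg_valuation hc,
      ← zpow_natCast, ← zpow_mul, inv_pow, ← zpow_natCast, ← zpow_neg, ← zpow_add₀ hp0.ne']
    congr 1
    ring
  have h2 := congrArg (· ^ N) h
  simp only [key a ha, key b hb] at h2
  have h3 := zpow_right_injective₀ hp0 hp1.ne' h2
  have h4 : (i : ℤ) % N = (j : ℤ) % N := by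
    have : (i : ℤ) = j + N * (b.valuation - a.valuation) := by linarith
    rw [this, Int.add_mul_emod_self_left]
  rw [Int.emod_eq_of_lt (by positivity) (mod_cast hi),
    Int.emod_eq_of_lt (by positivity) (mod_cast hj)] at h4
  exact_mod_cast h4

/-- If `‖x‖ ^ N = p⁻¹`, then `x` is not a root of a nonzero polynomial of degree less than `N`. -/
lemma le_natDegree_of_aeval_eq_zero (hnorm : ∀ x : ℚ_[p], ‖algebraMap ℚ_[p] K x‖ = ‖x‖)
    {x : K} {N : ℕ} (hx : ‖x‖ ^ N = (p : ℝ)⁻¹) {q : ℚ_[p][X]} (hq : q ≠ 0)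
    (hqx : aeval x q = 0) : N ≤ q.natDegree := by
  have := isUltrametricDist_of_norm_algebraMap hnorm
  by_contra! hlt
  have hp0 : (0 : ℝ) < p := mod_cast (Fact.out : p.Prime).pos
  have hx0 : ‖x‖ ≠ 0 := by
    intro h0
    have hN : N ≠ 0 := by omega
    rw [h0, zero_pow hN] at hx
    exact (inv_pos.2 hp0).ne hx
  have hterm (i : ℕ) : ‖algebraMap ℚ_[p] K (q.coeff i) * x ^ i‖ = ‖q.coeff i‖ * ‖x‖ ^ i := by
    rw [norm_mul, hnorm, norm_pow]
  have hne : q.support.Nonempty := nonempty_support_iff.2 hq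
  have hsum := IsUltrametricDist.norm_sum_eq_sup'_of_pairwise_ne hne
    (f := fun i => algebraMap ℚ_[p] K (q.coeff i) * x ^ i) <| by
      intro i hi j hj hij h
      simp only [hterm] at h
      exact hij <| index_eq_of_norm_mul_pow_eq hx (mem_support_iff.1 hi) (mem_support_iff.1 hj)
        ((le_natDegree_of_mem_supp i hi).trans_lt hlt)
        ((le_natDegree_of_mem_supp j hj).trans_lt hlt) h
  rw [aeval_eq_sum_range, ← sum_over_range q (f := fun i a => a • x ^ i) (by simp),
    Polynomial.sum_def] at hqx
  simp only [Algebra.smul_def] at hqx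
  rw [hqx, norm_zero] at hsum
  obtain ⟨i, hi⟩ := hne
  have hle := Finset.le_sup' (fun i => ‖algebraMap ℚ_[p] K (q.coeff i) * x ^ i‖) hi
  rw [← hsum] at hle
  simp only [hterm] at hle
  have : 0 < ‖q.coeff i‖ := norm_pos_iff.2 (mem_support_iff.1 hi)
  have : 0 < ‖x‖ := lt_of_le_of_ne (norm_nonneg x) (Ne.symm hx0)
  have : 0 < ‖q.coeff i‖ * ‖x‖ ^ i := by positivity
  linarith

/-- A root of a polynomial of degree `N` whose norm satisfies `‖x‖ ^ N = p⁻¹` generates an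
extension of degree `N`. -/
lemma finrank_adjoin_eq_of_norm_pow_eq (hnorm : ∀ x : ℚ_[p], ‖algebraMap ℚ_[p] K x‖ = ‖x‖)
    {x : K} {N : ℕ} (hx : ‖x‖ ^ N = (p : ℝ)⁻¹) {q : ℚ_[p][X]} (hq : q ≠ 0)
    (hqN : q.natDegree = N) (hqx : aeval x q = 0) :
    Module.finrank ℚ_[p] (IntermediateField.adjoin ℚ_[p] {x}) = N := by
  have hint : IsIntegral ℚ_[p] x := isAlgebraic_iff_isIntegral.1 ⟨q, hq, hqx⟩
  rw [IntermediateField.adjoin.finrank hint]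
  exact le_antisymm (hqN ▸ natDegree_le_of_dvd (minpoly.dvd _ x hqx) hq)
    (le_natDegree_of_aeval_eq_zero hnorm hx (minpoly.ne_zero hint) (minpoly.aeval _ x))

end Ultrametric

section LubinTate

variable {p : ℕ} [Fact p.Prime] {K : Type*} [NormedField K] [Algebra ℚ_[p] K] {α : ℕ → ℚ_[p]}

lemma natDegree_X_pow_add_sum_Icc (α : ℕ → ℚ_[p]) :
    (X ^ p + ∑ i ∈ Finset.Icc 1 (p - 1), C (α i) * X ^ i).natDegree = p := by
  have hp := (Fact.out : p.Prime).pos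
  have hle : (∑ i ∈ Finset.Icc 1 (p - 1), C (α i) * X ^ i).natDegree ≤ p - 1 :=
    natDegree_sum_le_of_forall_le _ _ fun i hi =>
      (natDegree_C_mul_X_pow_le _ _).trans (Finset.mem_Icc.1 hi).2
  rw [natDegree_add_eq_left_of_natDegree_lt (by rw [natDegree_X_pow]; omega), natDegree_X_pow]

lemma coeff_zero_X_pow_add_sum_Icc (α : ℕ → ℚ_[p]) :
    (X ^ p + ∑ i ∈ Finset.Icc 1 (p - 1), C (α i) * X ^ i).coeff 0 = 0 := by
  have hp := (Fact.out : p.Prime).ne_zero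
  rw [coeff_zero_eq_eval_zero, eval_add, eval_finsetSum, Finset.sum_eq_zero]
  · simp [hp]
  · intro i hi
    have : i ≠ 0 := by have := (Finset.mem_Icc.1 hi).1; omega
    simp [this]

/-- The terms of a preimage tower of `0` under `f` are roots of polynomials of the expected degree. -/
lemma exists_natDegree_eq_aeval_eq_zero {f : ℚ_[p][X]} (hdeg : f.natDegree = p)
    (hf0 : f.coeff 0 = 0) {π : ℕ → K} (hπ0 : π 0 = 0)
    (hπ : ∀ n : ℕ, aeval (π (n + 1)) f = π n) (hπ1 : π 1 ≠ 0) (n : ℕ) :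
    ∃ q : ℚ_[p][X], q.natDegree = (p - 1) * p ^ n ∧ aeval (π (n + 1)) q = 0 := by
  induction n with
  | zero =>
    refine ⟨f.divX, by rw [natDegree_divX_eq_natDegree_tsub_one, hdeg, pow_zero, mul_one], ?_⟩
    have h := hπ 0
    rw [← divX_mul_X_add f, hf0, C_0, add_zero, map_mul, aeval_X, hπ0] at h
    exact (mul_eq_zero.1 h).resolve_right hπ1
  | succ n ih =>
    obtain ⟨q, hq, hqx⟩ := ih
    exact ⟨q.comp f, by rw [natDegree_comp, hq, hdeg, pow_succ, mul_assoc],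
      by rw [aeval_comp, hπ, hqx]⟩

lemma norm_sum_Icc_le [IsUltrametricDist K]
    (hnorm : ∀ x : ℚ_[p], ‖algebraMap ℚ_[p] K x‖ = ‖x‖)
    (hα : ∀ i, 1 ≤ i → i ≤ p - 1 → ‖α i‖ ≤ (p : ℝ)⁻¹) {x : K} {C : ℝ} {m : ℕ} (hm : 1 ≤ m)
    (hC : 0 ≤ C) (hx : ∀ i, m ≤ i → i ≤ p - 1 → ‖x‖ ^ i ≤ C) :
    ‖∑ i ∈ Finset.Icc m (p - 1), algebraMap ℚ_[p] K (α i) * x ^ i‖ ≤ (p : ℝ)⁻¹ * C := by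
  refine IsUltrametricDist.norm_sum_le_of_forall_le_of_nonneg (by positivity) fun i hi => ?_
  rw [Finset.mem_Icc] at hi
  rw [norm_mul, hnorm, norm_pow]
  exact mul_le_mul (hα i (hm.trans hi.1) hi.2) (hx i hi.1 hi.2) (by positivity) (by positivity)

variable {f : ℚ_[p][X]}

lemma aeval_X_pow_add_sum_Icc (hf : f = X ^ p + ∑ i ∈ Finset.Icc 1 (p - 1), C (α i) * X ^ i)
    (x : K) :
    aeval x f = x ^ p + ∑ i ∈ Finset.Icc 1 (p - 1), algebraMap ℚ_[p] K (α i) * x ^ i := by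
  simp [hf]

lemma norm_lt_one_of_norm_aeval_lt_one [IsUltrametricDist K]
    (hnorm : ∀ x : ℚ_[p], ‖algebraMap ℚ_[p] K x‖ = ‖x‖)
    (hα : ∀ i, 1 ≤ i → i ≤ p - 1 → ‖α i‖ ≤ (p : ℝ)⁻¹)
    (hf : f = X ^ p + ∑ i ∈ Finset.Icc 1 (p - 1), C (α i) * X ^ i) {x : K}
    (hx : ‖aeval x f‖ < 1) : ‖x‖ < 1 := by
  have hp1 : (1 : ℝ) < p := mod_cast (Fact.out : p.Prime).one_lt
  by_contra! h1
  have hsum := norm_sum_Icc_le hnorm hα (x := x) (C := ‖x‖ ^ p) le_rfl (by positivity)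
    fun i _ hi => pow_le_pow_right₀ h1 (hi.trans (Nat.sub_le p 1))
  have hlt : (p : ℝ)⁻¹ * ‖x‖ ^ p < ‖x ^ p‖ := by
    rw [norm_pow]
    exact mul_lt_of_lt_one_left (by positivity) (inv_lt_one_of_one_lt₀ hp1)
  rw [aeval_X_pow_add_sum_Icc hf,
    IsUltrametricDist.norm_add_eq_max_of_norm_ne_norm (hsum.trans_lt hlt).ne',
    max_eq_left (hsum.trans_lt hlt).le, norm_pow] at hx
  exact absurd (one_le_pow₀ h1) hx.not_ge

/-- The nonzero roots of `f` have norm `p ^ (-1 / (p - 1))`. -/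
lemma norm_pow_eq_of_aeval_eq_zero [IsUltrametricDist K]
    (hnorm : ∀ x : ℚ_[p], ‖algebraMap ℚ_[p] K x‖ = ‖x‖)
    (hα : ∀ i, 1 ≤ i → i ≤ p - 1 → ‖α i‖ ≤ (p : ℝ)⁻¹) (hα1 : ‖α 1‖ = (p : ℝ)⁻¹)
    (hf : f = X ^ p + ∑ i ∈ Finset.Icc 1 (p - 1), C (α i) * X ^ i) {x : K} (hx0 : x ≠ 0)
    (hx : aeval x f = 0) : ‖x‖ ^ (p - 1) = (p : ℝ)⁻¹ := by
  have hp2 := (Fact.out : p.Prime).two_le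
  have hp0 : (0 : ℝ) < (p : ℝ)⁻¹ := inv_pos.2 (by positivity)
  have h1 : ‖x‖ < 1 := norm_lt_one_of_norm_aeval_lt_one hnorm hα hf (by simp [hx])
  have hpos : 0 < ‖x‖ := norm_pos_iff.2 hx0
  have hsum := norm_sum_Icc_le hnorm hα (x := x) (C := ‖x‖ ^ 2) one_le_two (by positivity)
    fun i hi _ => pow_le_pow_of_le_one hpos.le h1.le hi
  have hlin : ‖algebraMap ℚ_[p] K (α 1) * x‖ = (p : ℝ)⁻¹ * ‖x‖ := by rw [norm_mul, hnorm, hα1]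
  have hlt : ‖∑ i ∈ Finset.Icc 2 (p - 1), algebraMap ℚ_[p] K (α i) * x ^ i‖
      < ‖algebraMap ℚ_[p] K (α 1) * x‖ := by
    rw [hlin]
    refine hsum.trans_lt (mul_lt_mul_of_pos_left ?_ hp0)
    nlinarith
  rw [aeval_X_pow_add_sum_Icc hf, ← Finset.add_sum_Ioc_eq_sum_Icc (by omega : 1 ≤ p - 1),
    ← Finset.Icc_add_one_left_eq_Ioc, one_add_one_eq_two, pow_one, add_eq_zero_iff_eq_neg] at hx
  have hxp := congrArg norm hx
  rw [norm_neg, IsUltrametricDist.norm_add_eq_max_of_norm_ne_norm hlt.ne', max_eq_left hlt.le,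
    hlin, norm_pow, ← pow_sub_one_mul (by omega : p ≠ 0)] at hxp
  exact mul_right_cancel₀ hpos.ne' hxp

/-- If `p⁻¹ ≤ ‖f x‖ < 1`, then `‖x‖ ^ p = ‖f x‖`. -/
lemma norm_pow_eq_norm_aeval [IsUltrametricDist K]
    (hnorm : ∀ x : ℚ_[p], ‖algebraMap ℚ_[p] K x‖ = ‖x‖)
    (hα : ∀ i, 1 ≤ i → i ≤ p - 1 → ‖α i‖ ≤ (p : ℝ)⁻¹)
    (hf : f = X ^ p + ∑ i ∈ Finset.Icc 1 (p - 1), C (α i) * X ^ i) {x : K}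
    (hlow : (p : ℝ)⁻¹ ≤ ‖aeval x f‖) (hlt : ‖aeval x f‖ < 1) : ‖x‖ ^ p = ‖aeval x f‖ := by
  have hp0 : (0 : ℝ) < (p : ℝ)⁻¹ :=
    inv_pos.2 (mod_cast (Fact.out : p.Prime).pos)
  have h1 : ‖x‖ < 1 := norm_lt_one_of_norm_aeval_lt_one hnorm hα hf hlt
  have hsum := norm_sum_Icc_le hnorm hα (x := x) (C := ‖x‖) le_rfl (by positivity)
    fun i hi _ => pow_le_of_le_one (norm_nonneg x) h1.le (by omega)
  have hsmall : ‖-∑ i ∈ Finset.Icc 1 (p - 1), algebraMap ℚ_[p] K (α i) * x ^ i‖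
      < ‖aeval x f‖ := by
    rw [norm_neg]
    exact (hsum.trans_lt (mul_lt_of_lt_one_right hp0 h1)).trans_le hlow
  have hxp : x ^ p = aeval x f + -∑ i ∈ Finset.Icc 1 (p - 1), algebraMap ℚ_[p] K (α i) * x ^ i := by
    rw [aeval_X_pow_add_sum_Icc hf, add_neg_cancel_right]
  rw [← norm_pow, hxp, IsUltrametricDist.norm_add_eq_max_of_norm_ne_norm hsmall.ne',
    max_eq_left hsmall.le]

end LubinTate

/-- For `n ≥ 1`, `[ℚ_p(π_n) : ℚ_p] = (p−1)·p^{n−1}` and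
`‖π_n‖^{(p−1)·p^{n−1}} = p⁻¹` (so `ℚ_p(π_n)/ℚ_p` is totally ramified with uniformizer `π_n`). -/
theorem tower_degree_and_uniformizer
    {p : ℕ} [Fact p.Prime]
    -- `K` is a fixed algebraic closure of `ℚ_p` with the unique extension of the p-adic norm
    {K : Type} [NormedField K] [Algebra ℚ_[p] K] [IsAlgClosure ℚ_[p] K]
    (hnorm : ∀ x : ℚ_[p], ‖algebraMap ℚ_[p] K x‖ = ‖x‖)
    -- the polynomial f(X) = X^p + α_{p-1} X^{p-1} + ⋯ + α_1 X, with α_i ∈ pℤ_p, v_p(α_1) = 1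
    (α : ℕ → ℚ_[p])
    (hα : ∀ i, 1 ≤ i → i ≤ p - 1 → ‖α i‖ ≤ (p : ℝ)⁻¹)
    (hα1 : ‖α 1‖ = (p : ℝ)⁻¹)
    (f : ℚ_[p][X])
    (hf : f = X ^ p + ∑ i ∈ Finset.Icc 1 (p - 1), C (α i) * X ^ i)
    -- the tower π_0 = 0, f(π_n) = π_{n−1}, π_n ≠ 0 for n ≥ 1
    (π : ℕ → K) (hπ0 : π 0 = 0)
    (hπ : ∀ n : ℕ, Polynomial.aeval (π (n + 1)) f = π n)
    (hπne : ∀ n : ℕ, π (n + 1) ≠ 0) :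
    ∀ n : ℕ, 1 ≤ n →
      Module.finrank ℚ_[p] (IntermediateField.adjoin ℚ_[p] {π n}) = (p - 1) * p ^ (n - 1) ∧
      ‖π n‖ ^ ((p - 1) * p ^ (n - 1)) = (p : ℝ)⁻¹ := by
  have := isUltrametricDist_of_norm_algebraMap hnorm
  have hp2 := (Fact.out : p.Prime).two_le
  have hp1 : (1 : ℝ) < p := mod_cast (Fact.out : p.Prime).one_lt
  have hpow (n : ℕ) : ‖π (n + 1)‖ ^ ((p - 1) * p ^ n) = (p : ℝ)⁻¹ := by
    induction n with
    | zero =>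
      rw [pow_zero, mul_one]
      exact norm_pow_eq_of_aeval_eq_zero hnorm hα hα1 hf (hπne 0) ((hπ 0).trans hπ0)
    | succ n ih =>
      have hN : (p - 1) * p ^ n ≠ 0 := mul_ne_zero (by omega) (pow_ne_zero _ (by omega))
      have hlt : ‖π (n + 1)‖ < 1 := by
        rw [← pow_lt_one_iff_of_nonneg (norm_nonneg _) hN, ih]
        exact inv_lt_one_of_one_lt₀ hp1
      have hlow : (p : ℝ)⁻¹ ≤ ‖π (n + 1)‖ :=
        ih ▸ pow_le_of_le_one (norm_nonneg _) hlt.le hN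
      rw [← hπ (n + 1)] at hlow hlt
      have h := norm_pow_eq_norm_aeval hnorm hα hf hlow hlt
      rw [pow_succ, ← mul_assoc, mul_comm _ p, pow_mul, h, hπ, ih]
  intro n hn
  obtain ⟨n, rfl⟩ := Nat.exists_eq_add_of_le' hn
  rw [Nat.add_sub_cancel]
  obtain ⟨q, hqN, hqx⟩ := exists_natDegree_eq_aeval_eq_zero
    (hf ▸ natDegree_X_pow_add_sum_Icc α) (hf ▸ coeff_zero_X_pow_add_sum_Icc α) hπ0 hπ (hπne 0) n
  have hN : (p - 1) * p ^ n ≠ 0 := mul_ne_zero (by omega) (pow_ne_zero _ (by omega))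
  exact ⟨finrank_adjoin_eq_of_norm_pow_eq hnorm (hpow n)
    (ne_zero_of_natDegree_gt (hqN ▸ Nat.pos_of_ne_zero hN)) hqN hqx, hpow n⟩
end

section
/- Let L be a finite field extension of ℚ_p with ring of integers 𝒪_L (the integral closure of ℤ_p in L), and let π ∈ 𝒪_L be a uniformizer, i.e. an irreducible element of the discrete valuation ring 𝒪_L. Then the polynomial f(X) − π is irreducible over L (of degree p), and every root π′ of f(X) − π in an algebraic closure of L satisfies ‖π′‖^p = ‖π‖, where ‖·‖ is the unique extension of the p-adic absolute value; in particular L(π′)/L is totally ramified of degree p and π′ is a uniformizer of L(π′). -/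
open Polynomial

set_option synthInstance.maxHeartbeats 1000000
set_option maxHeartbeats 1000000

/-- The ring of integers of a `p`-adic field `L`: the integral closure of `ℤ_p` in `L`. -/
noncomputable def ringOfIntegers (p : ℕ) [Fact p.Prime] (L : Type) [Field L]
    [Algebra ℚ_[p] L] : Subring L :=
  letI : Algebra ℤ_[p] L := ((algebraMap ℚ_[p] L).comp (algebraMap ℤ_[p] ℚ_[p])).toAlgebra
  (integralClosure ℤ_[p] L).toSubring

/-- A normed field extending an ultrametric normed field is ultrametric. -/
theorem isUltrametricDist_of_norm_algebraMap_s9 {k L : Type*} [NormedField k] [IsUltrametricDist k]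
    [NormedField L] [Algebra k L] (h : ∀ x : k, ‖algebraMap k L x‖ = ‖x‖) :
    IsUltrametricDist L := by
  refine IsUltrametricDist.isUltrametricDist_of_forall_norm_natCast_le_one fun n => ?_
  rw [← map_natCast (algebraMap k L), h]
  exact IsUltrametricDist.norm_natCast_le_one k n

/-- The ring of integers of a finite extension of `ℚ_p` is the closed unit ball. -/
theorem mem_ringOfIntegers_iff_norm_le_one {p : ℕ} [Fact p.Prime] {L : Type} [NormedField L]
    [Algebra ℚ_[p] L] [FiniteDimensional ℚ_[p] L]
    (h : ∀ x : ℚ_[p], ‖algebraMap ℚ_[p] L x‖ = ‖x‖) {x : L} :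
    x ∈ ringOfIntegers p L ↔ ‖x‖ ≤ 1 := by
  let : Algebra ℤ_[p] L := ((algebraMap ℚ_[p] L).comp (algebraMap ℤ_[p] ℚ_[p])).toAlgebra
  have : IsScalarTower ℤ_[p] ℚ_[p] L := IsScalarTower.of_algebraMap_eq fun _ => rfl
  have hx : IsIntegral ℚ_[p] x := Algebra.IsIntegral.isIntegral x
  have hnorm : ‖x‖ = spectralNorm ℚ_[p] L x :=
    spectralNorm_unique_field_norm_ext (f := NormedField.toAbsoluteValue L) h x
  rw [hnorm, spectralNorm, spectralValue_le_one_iff (minpoly.monic hx)]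
  change IsIntegral ℤ_[p] x ↔ _
  constructor
  · intro hint n
    rw [minpoly.isIntegrallyClosed_eq_field_fractions' ℚ_[p] hint, coeff_map]
    exact PadicInt.norm_le_one _
  · intro hc
    have hl : minpoly ℚ_[p] x ∈ lifts (algebraMap ℤ_[p] ℚ_[p]) :=
      (lifts_iff_coeff_lifts _).2 fun n => ⟨⟨_, hc n⟩, rfl⟩
    obtain ⟨q, hq, -, hm⟩ := lifts_and_natDegree_eq_and_monic hl (minpoly.monic hx)
    refine ⟨q, hm, ?_⟩
    rw [← aeval_def, ← aeval_map_algebraMap ℚ_[p], hq, minpoly.aeval]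

/-- An irreducible element of the ring of integers has the largest norm less than one. -/
theorem norm_lt_one_and_norm_le_of_irreducible {p : ℕ} [Fact p.Prime] {L : Type} [NormedField L]
    [Algebra ℚ_[p] L] [FiniteDimensional ℚ_[p] L]
    (h : ∀ x : ℚ_[p], ‖algebraMap ℚ_[p] L x‖ = ‖x‖) {π : L} (hmem : π ∈ ringOfIntegers p L)
    (hirr : Irreducible (⟨π, hmem⟩ : ringOfIntegers p L)) :
    ‖π‖ < 1 ∧ ∀ x : L, ‖x‖ < 1 → ‖x‖ ≤ ‖π‖ := by
  have hunit : ∀ (y : L) (hy : y ∈ ringOfIntegers p L),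
      IsUnit (⟨y, hy⟩ : ringOfIntegers p L) ↔ ‖y‖ = 1 := by
    refine fun y hy => ⟨fun hu => ?_, fun hn => ?_⟩
    · obtain ⟨z, hz⟩ := hu.exists_right_inv
      have hz' : y * (z : L) = 1 := congrArg Subtype.val hz
      have h1 := (mem_ringOfIntegers_iff_norm_le_one h).1 hy
      have h2 := (mem_ringOfIntegers_iff_norm_le_one h).1 z.2
      have h3 : ‖y‖ * ‖(z : L)‖ = 1 := by rw [← norm_mul, hz', norm_one]
      nlinarith [norm_nonneg y]
    · have hy0 : y ≠ 0 := norm_ne_zero_iff.1 (by simp [hn])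
      refine IsUnit.of_mul_eq_one
        ⟨y⁻¹, (mem_ringOfIntegers_iff_norm_le_one h).2 (by simp [hn])⟩ ?_
      exact Subtype.ext (mul_inv_cancel₀ hy0)
  have hle := (mem_ringOfIntegers_iff_norm_le_one h).1 hmem
  refine ⟨lt_of_le_of_ne hle fun hn => hirr.not_isUnit ((hunit π hmem).2 hn), fun x hx => ?_⟩
  by_contra! hlt
  have hx0 : 0 < ‖x‖ := (norm_nonneg π).trans_lt hlt
  have hdiv : ‖π / x‖ < 1 := by rwa [norm_div, div_lt_one hx0]
  have hx' := (mem_ringOfIntegers_iff_norm_le_one h).2 hx.le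
  have hdiv' := (mem_ringOfIntegers_iff_norm_le_one h).2 hdiv.le
  have hfac : (⟨π, hmem⟩ : ringOfIntegers p L) = ⟨x, hx'⟩ * ⟨π / x, hdiv'⟩ :=
    Subtype.ext (mul_div_cancel₀ π (norm_pos_iff.1 hx0)).symm
  rcases hirr.isUnit_or_isUnit hfac with hu | hu
  · exact hx.ne ((hunit _ _).1 hu)
  · exact hdiv.ne ((hunit _ _).1 hu)

/-- **Eisenstein's criterion** for a monic polynomial over an ultrametric normed field whose
constant coefficient has the largest norm less than one. -/
theorem irreducible_of_norm_coeff_lt_one {L : Type*} [NormedField L] [IsUltrametricDist L]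
    {g : L[X]} (hg : g.Monic) (hdeg : 0 < g.natDegree)
    (hcoeff : ∀ i < g.natDegree, ‖g.coeff i‖ < 1) (h0 : g.coeff 0 ≠ 0)
    (hmax : ∀ x : L, ‖x‖ < 1 → ‖x‖ ≤ ‖g.coeff 0‖) : Irreducible g := by
  let V : ValuationSubring L := (NormedField.valuation (K := L)).valuationSubring
  have hV : ∀ x : L, x ∈ V ↔ ‖x‖ ≤ 1 := fun x => by
    rw [Valuation.mem_valuationSubring_iff, NormedField.valuation_apply, ← NNReal.coe_le_coe]
    simp
  have hmem : ∀ i, g.coeff i ∈ V := fun i => by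
    rw [hV]
    rcases lt_trichotomy i g.natDegree with hi | rfl | hi
    · exact (hcoeff i hi).le
    · simp [hg.coeff_natDegree]
    · simp [coeff_eq_zero_of_natDegree_lt hi]
  obtain ⟨q, rfl, hqdeg, hq⟩ := lifts_and_natDegree_eq_and_monic
    ((lifts_iff_coeff_lifts (f := algebraMap V L) g).2 fun i => ⟨⟨_, hmem i⟩, rfl⟩) hg
  rw [← hq.irreducible_iff_irreducible_map_fraction_map]
  have hco : ∀ i, (q.map (algebraMap V L)).coeff i = (q.coeff i : L) := fun i => coeff_map _ _
  simp only [hco, ← hqdeg] at hcoeff h0 hmax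
  rw [← hqdeg] at hdeg
  have hnorm : ∀ x : V, x ∈ IsLocalRing.maximalIdeal V ↔ ‖(x : L)‖ < 1 := fun x => by
    rw [Valuation.mem_maximalIdeal_iff, NormedField.valuation_apply, ← NNReal.coe_lt_coe]
    simp
  refine IsEisensteinAt.irreducible (𝓟 := IsLocalRing.maximalIdeal V) ⟨?_, ?_, ?_⟩
    (IsLocalRing.maximalIdeal.isMaximal V).isPrime hq.isPrimitive hdeg
  · rw [hq.leadingCoeff, hnorm]
    simp
  · exact fun {i} hi => (hnorm _).2 (hcoeff i hi)
  · have hsq : ∀ x ∈ IsLocalRing.maximalIdeal V ^ 2, ‖(x : L)‖ ≤ ‖(q.coeff 0 : L)‖ ^ 2 := by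
      intro x hx
      rw [pow_two] at hx
      refine Submodule.mul_induction_on hx (fun a ha b hb => ?_) fun a b ha hb => ?_
      · rw [pow_two]
        simp only [MulMemClass.coe_mul, norm_mul]
        exact mul_le_mul (hmax _ ((hnorm a).1 ha)) (hmax _ ((hnorm b).1 hb)) (norm_nonneg _)
          (norm_nonneg _)
      · exact (IsUltrametricDist.norm_add_le_max _ _).trans (max_le ha hb)
    intro hx
    have h1 := hsq _ hx
    nlinarith [hcoeff 0 hdeg, norm_pos_iff.2 h0]

/-- If all the lower coefficients of a monic polynomial of degree `n` have norm at most that of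
the constant coefficient `c`, and `0 < ‖c‖ < 1`, then every root `y` satisfies `‖y‖ ^ n = ‖c‖`. -/
theorem norm_pow_natDegree_eq_of_isRoot {K : Type*} [NormedField K] [IsUltrametricDist K]
    {g : K[X]} (hg : g.Monic) (hdeg : 0 < g.natDegree)
    (hcoeff : ∀ i < g.natDegree, ‖g.coeff i‖ ≤ ‖g.coeff 0‖) (h0 : g.coeff 0 ≠ 0)
    (h1 : ‖g.coeff 0‖ < 1) {y : K} (hy : g.IsRoot y) : ‖y‖ ^ g.natDegree = ‖g.coeff 0‖ := by
  have hc : 0 < ‖g.coeff 0‖ := norm_pos_iff.2 h0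
  have hroot : ∑ i ∈ Finset.range g.natDegree, g.coeff i * y ^ i = -y ^ g.natDegree := by
    have := hy.eq_zero
    rw [eval_eq_sum_range, Finset.sum_range_succ, hg.coeff_natDegree, one_mul] at this
    exact eq_neg_of_add_eq_zero_left this
  have hnroot := congrArg norm hroot
  rw [norm_neg, norm_pow] at hnroot
  rcases le_or_gt 1 ‖y‖ with hy1 | hy1
  · have hle : ‖∑ i ∈ Finset.range g.natDegree, g.coeff i * y ^ i‖ ≤
        ‖g.coeff 0‖ * ‖y‖ ^ g.natDegree := by
      refine IsUltrametricDist.norm_sum_le_of_forall_le_of_nonneg (by positivity) fun i hi => ?_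
      have hi := Finset.mem_range.1 hi
      rw [norm_mul, norm_pow]
      exact mul_le_mul (hcoeff i hi) (pow_le_pow_right₀ hy1 hi.le) (by positivity) hc.le
    have : 0 < ‖y‖ ^ g.natDegree := by positivity
    nlinarith
  · obtain ⟨n, hn⟩ := Nat.exists_eq_succ_of_ne_zero hdeg.ne'
    rw [← hnroot]
    rw [hn] at hcoeff ⊢
    rw [Finset.sum_range_succ', pow_zero, mul_one]
    have hle : ‖∑ i ∈ Finset.range n, g.coeff (i + 1) * y ^ (i + 1)‖ ≤ ‖g.coeff 0‖ * ‖y‖ := by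
      refine IsUltrametricDist.norm_sum_le_of_forall_le_of_nonneg (by positivity) fun i hi => ?_
      have hi := Finset.mem_range.1 hi
      rw [norm_mul, norm_pow]
      exact mul_le_mul (hcoeff _ (by omega))
        (pow_le_of_le_one (norm_nonneg _) hy1.le (by omega)) (by positivity) hc.le
    have hlt := hle.trans_lt (mul_lt_of_lt_one_right hc hy1)
    rw [IsUltrametricDist.norm_add_eq_max_of_norm_ne_norm hlt.ne, max_eq_right hlt.le]

/-- The Eisenstein step: if `π` is a uniformizer of a finite extension `L/ℚ_p`
(an irreducible element of its ring of integers), then `f(X) − π` is irreducible over `L` of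
degree `p`, and every root `π′` satisfies `‖π′‖^p = ‖π‖`; in particular `L(π′)/L` is (totally
ramified) of degree `p`. -/
theorem eisenstein_step
    {p : ℕ} [Fact p.Prime]
    -- `L` is a finite extension of `ℚ_p` with the unique extension of the p-adic norm
    {L : Type} [NormedField L] [Algebra ℚ_[p] L] [FiniteDimensional ℚ_[p] L]
    (hnormL : ∀ x : ℚ_[p], ‖algebraMap ℚ_[p] L x‖ = ‖x‖)
    -- `K` is an algebraic closure of `L` with the unique extension of the norm of `L`
    {K : Type} [NormedField K] [Algebra L K] [IsAlgClosure L K]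
    (hnormK : ∀ y : L, ‖algebraMap L K y‖ = ‖y‖)
    -- the polynomial f(X) = X^p + α_{p-1} X^{p-1} + ⋯ + α_1 X, with α_i ∈ pℤ_p, v_p(α_1) = 1
    (α : ℕ → ℚ_[p])
    (hα : ∀ i, 1 ≤ i → i ≤ p - 1 → ‖α i‖ ≤ (p : ℝ)⁻¹)
    (hα1 : ‖α 1‖ = (p : ℝ)⁻¹)
    (f : ℚ_[p][X])
    (hf : f = X ^ p + ∑ i ∈ Finset.Icc 1 (p - 1), C (α i) * X ^ i)
    -- `π` is a uniformizer: an irreducible element of the ring of integers of `L`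
    (π : L) (hmem : π ∈ ringOfIntegers p L)
    (hirr : Irreducible (⟨π, hmem⟩ : ringOfIntegers p L)) :
    Irreducible (f.map (algebraMap ℚ_[p] L) - C π) ∧
    (f.map (algebraMap ℚ_[p] L) - C π).natDegree = p ∧
    ∀ π' : K, Polynomial.aeval π' (f.map (algebraMap ℚ_[p] L) - C π) = 0 →
      ‖π'‖ ^ p = ‖algebraMap L K π‖ ∧
      Module.finrank L (IntermediateField.adjoin L {π'}) = p := by
  have hp : 1 < p := (Fact.out : p.Prime).one_lt
  have : IsUltrametricDist L := isUltrametricDist_of_norm_algebraMap_s9 hnormL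
  have : IsUltrametricDist K := isUltrametricDist_of_norm_algebraMap_s9 hnormK
  obtain ⟨hπ1, hmax⟩ := norm_lt_one_and_norm_le_of_irreducible hnormL hmem hirr
  have hπ0 : π ≠ 0 := fun h => hirr.ne_zero (Subtype.ext h)
  set g : L[X] := f.map (algebraMap ℚ_[p] L) - C π with hgdef
  have hg : g =
      X ^ p + (∑ i ∈ Finset.Icc 1 (p - 1), C (algebraMap ℚ_[p] L (α i)) * X ^ i - C π) := by
    simp [hgdef, hf, Polynomial.map_sum, add_sub_assoc]
  have hlow : (∑ i ∈ Finset.Icc 1 (p - 1), C (algebraMap ℚ_[p] L (α i)) * X ^ i - C π).degree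
      < (p : WithBot ℕ) := by
    refine (degree_sub_le _ _).trans_lt (max_lt ?_ ?_)
    · refine (degree_sum_le _ _).trans_lt ((Finset.sup_lt_iff (WithBot.bot_lt_coe p)).2 ?_)
      intro i hi
      have hi := Finset.mem_Icc.1 hi
      exact (degree_C_mul_X_pow_le _ _).trans_lt (WithBot.coe_lt_coe.2 (by omega : i < p))
    · exact degree_C_le.trans_lt (by exact_mod_cast hp.le)
  have hmonic : g.Monic := hg ▸ monic_X_pow_add hlow
  have hdeg : g.natDegree = p := by
    rw [hg]
    refine natDegree_eq_of_degree_eq_some ?_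
    rw [degree_add_eq_left_of_degree_lt (by rwa [degree_X_pow]), degree_X_pow]
  have hcoeff0 : g.coeff 0 = -π := by
    simp [hg, coeff_X_pow, finsetSum_coeff, (zero_lt_one.trans hp).ne]
  have hcoeff : ∀ i, i < g.natDegree → ‖g.coeff i‖ < 1 := by
    intro i hi
    rw [hdeg] at hi
    rcases Nat.eq_zero_or_pos i with rfl | hi0
    · rwa [hcoeff0, norm_neg]
    · have hci : g.coeff i = algebraMap ℚ_[p] L (α i) := by
        simp [hg, coeff_X_pow, finsetSum_coeff, coeff_C, hi.ne, hi0.ne']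
        exact fun h => absurd (h hi0) (by omega)
      rw [hci, hnormL]
      exact (hα i hi0 (by omega)).trans_lt (inv_lt_one_of_one_lt₀ (by exact_mod_cast hp))
  have hgirr : Irreducible g := irreducible_of_norm_coeff_lt_one hmonic (by omega) hcoeff
    (by simpa [hcoeff0] using hπ0) (by simpa [hcoeff0] using hmax)
  refine ⟨hgirr, hdeg, fun π' hroot => ⟨?_, ?_⟩⟩
  · have hle : ∀ i < g.natDegree, ‖g.coeff i‖ ≤ ‖π‖ := fun i hi => hmax _ (hcoeff i hi)
    have hroot' : (g.map (algebraMap L K)).IsRoot π' := by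
      rwa [IsRoot, eval_map_algebraMap]
    have := norm_pow_natDegree_eq_of_isRoot (hmonic.map (algebraMap L K)) (by simp; omega)
      (by simpa [hnormK, hcoeff0] using hle) (by simpa [hcoeff0] using hπ0)
      (by simpa [hnormK, hcoeff0] using hπ1) hroot'
    simpa [hdeg, hcoeff0] using this
  · rw [IntermediateField.adjoin.finrank ⟨g, hmonic, hroot⟩,
      ← minpoly.eq_of_irreducible_of_monic hgirr hroot hmonic, hdeg]
end

section
/- For every m ∈ M, the ℤ_p-submodule N_F := span_{ℤ_p}{ F^i(m) : i ≥ 0 } is contained in the ℤ_p-submodule N := span_{ℤ_p}{ F^i(V^j(m)) : i, j ≥ 0 }, and the quotient N/N_F is finite. (In the paper's notation: ℤ_p[F]·𝐦 is a subgroup of finite index in M(𝐦) = 𝐃·𝐦.) -/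
open Polynomial in
/-- A submodule stable under `F` is stable under every polynomial in `F`. -/
theorem aeval_apply_mem_of_mem_invtSubmodule {R M : Type*} [CommRing R] [AddCommGroup M]
    [Module R M] {F : Module.End R M} {W : Submodule R M} (hW : W ∈ F.invtSubmodule) (q : R[X])
    {x : M} (hx : x ∈ W) : aeval F q x ∈ W := by
  have hpow (i : ℕ) : (F ^ i) x ∈ W := by
    induction i with
    | zero => simpa using hx
    | succ i ih => rw [pow_succ']; exact hW ih
  rw [aeval_eq_sum_range, LinearMap.sum_apply]
  exact W.sum_mem fun i _ => W.smul_mem _ (hpow i)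

/-- A finitely generated torsion module over `ℤ_[p]` is finite. -/
theorem PadicInt.finite_of_isTorsion {p : ℕ} [Fact p.Prime] {Q : Type*} [AddCommGroup Q]
    [Module ℤ_[p] Q] [Module.Finite ℤ_[p] Q] (hQ : Module.IsTorsion ℤ_[p] Q) : Finite Q := by
  obtain ⟨c, hc, hc0⟩ := Submodule.annihilator_top_inter_nonZeroDivisors hQ
  rw [SetLike.mem_coe, Submodule.mem_annihilator] at hc
  have hI : Ideal.span {c} ≠ ⊥ := by
    simpa [Ideal.span_singleton_eq_bot] using nonZeroDivisors.ne_zero hc0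
  have : Finite (ℤ_[p] ⧸ Ideal.span {c}) :=
    IsLocalRing.isOpen_iff_finite_quotient.mp (IsDedekindDomain.isOpen_of_ne_bot hI)
  have : Finite (Q ⧸ (⊤ : Submodule ℤ_[p] Q)) := inferInstance
  have hfin := Submodule.finite_quotient_smul (Ideal.span {c}) (Module.Finite.fg_top (M := Q))
  have hbot : Ideal.span {c} • (⊤ : Submodule ℤ_[p] Q) = ⊥ := by
    rw [eq_bot_iff, Submodule.ideal_span_singleton_smul]
    rintro _ ⟨x, -, rfl⟩
    exact hc x trivial
  rw [hbot] at hfin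
  exact .of_equiv _ (Submodule.quotEquivOfEqBot (⊥ : Submodule ℤ_[p] Q) rfl).toEquiv

/-- If `F ∘ V = V ∘ F = a` with `a ≠ 0`, then some nonzero multiple of `V` maps every `F`-stable
submodule into itself. -/
theorem exists_ne_zero_smul_apply_mem {R M : Type*} [CommRing R] [IsDomain R] [AddCommGroup M]
    [Module R M] [Module.Finite R M] [Module.Free R M] {F V : Module.End R M} {a : R} (ha : a ≠ 0)
    (hFV : F ∘ₗ V = a • LinearMap.id) (hVF : V ∘ₗ F = a • LinearMap.id) :
    ∃ c : R, c ≠ 0 ∧ ∀ W ∈ F.invtSubmodule, ∀ x ∈ W, c • V x ∈ W := by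
  refine ⟨F.charpoly.coeff 0, fun h0 => ?_, fun W hW x hx => ?_⟩
  · have hdet : LinearMap.det F * LinearMap.det V = a ^ Module.finrank R M := by
      rw [← LinearMap.det_comp, hFV, LinearMap.det_smul, LinearMap.det_id, mul_one]
    rw [LinearMap.det_eq_sign_charpoly_coeff, h0, mul_zero, zero_mul] at hdet
    exact pow_ne_zero _ ha hdet.symm
  · set g := F.charpoly.divX
    have hchar : F (Polynomial.aeval F g x) + F.charpoly.coeff 0 • x = 0 := by
      have h := LinearMap.congr_fun F.aeval_self_charpoly x
      rw [← F.charpoly.divX_mul_X_add, mul_comm] at h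
      rw [map_add, map_mul, Polynomial.aeval_X, Polynomial.aeval_C] at h
      simpa [Algebra.algebraMap_eq_smul_one] using h
    have hV : a • Polynomial.aeval F g x + F.charpoly.coeff 0 • V x = 0 := by
      have h := congrArg V hchar
      rw [map_add, map_smul, map_zero] at h
      rwa [← LinearMap.comp_apply V F, hVF] at h
    rw [← neg_eq_iff_add_eq_zero] at hV
    rw [← hV]
    exact W.neg_mem (W.smul_mem _ (aeval_apply_mem_of_mem_invtSubmodule hW g hx))


/-- For a torsion-free Dieudonné module `M` and `m ∈ M`, the submodule
`ℤ_p[F]·m` is contained in `𝐃·m = span{F^i V^j m}` with finite quotient. -/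
theorem span_frobenius_finite_index
    {p : ℕ} [Fact p.Prime]
    {M : Type} [AddCommGroup M] [Module ℤ_[p] M]
    [Module.Finite ℤ_[p] M] [Module.Free ℤ_[p] M]
    (F V : M →ₗ[ℤ_[p]] M)
    (hFV : F ∘ₗ V = (p : ℤ_[p]) • LinearMap.id)
    (hVF : V ∘ₗ F = (p : ℤ_[p]) • LinearMap.id)
    (m : M) :
    ∀ (NF N : Submodule ℤ_[p] M),
      NF = Submodule.span ℤ_[p] (Set.range fun i : ℕ => (F ^ i) m) →
      N = Submodule.span ℤ_[p] (Set.range fun ij : ℕ × ℕ => (F ^ ij.1) ((V ^ ij.2) m)) →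
      NF ≤ N ∧ Finite (N ⧸ (NF.comap N.subtype)) := by
  rintro NF N rfl rfl
  have hp : (p : ℤ_[p]) ≠ 0 := Nat.cast_ne_zero.mpr (Fact.out : p.Prime).ne_zero
  set W := Submodule.span ℤ_[p] (Set.range fun i : ℕ => (F ^ i) m)
  have hW : W ∈ Module.End.invtSubmodule F := by
    rw [Module.End.mem_invtSubmodule, Submodule.span_le]
    rintro _ ⟨i, rfl⟩
    exact Submodule.subset_span ⟨i + 1, by simp only [pow_succ']; rfl⟩
  refine ⟨Submodule.span_mono ?_, ?_⟩
  · rintro _ ⟨i, rfl⟩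
    exact ⟨(i, 0), by simp⟩
  obtain ⟨c, hc, hcV⟩ := exists_ne_zero_smul_apply_mem hp hFV hVF
  have hVpow (j : ℕ) : c ^ j • (V ^ j) m ∈ W := by
    induction j with
    | zero => exact Submodule.subset_span ⟨0, by simp⟩
    | succ j ih =>
      have h := hcV W hW _ ih
      rwa [map_smul, smul_smul, ← pow_succ', ← Module.End.mul_apply, ← pow_succ'] at h
  have hgen (i j : ℕ) : c ^ j • (F ^ i) ((V ^ j) m) ∈ W := by
    simpa using aeval_apply_mem_of_mem_invtSubmodule hW (Polynomial.X ^ i) (hVpow j)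
  apply PadicInt.finite_of_isTorsion (p := p)
  intro x
  obtain ⟨⟨x, hx⟩, rfl⟩ := Submodule.Quotient.mk_surjective _ x
  suffices ∃ d : ℤ_[p], d ≠ 0 ∧ d • x ∈ W by
    obtain ⟨d, hd, hdx⟩ := this
    refine ⟨⟨d, mem_nonZeroDivisors_of_ne_zero hd⟩, ?_⟩
    exact (Submodule.Quotient.mk_eq_zero _).mpr hdx
  induction hx using Submodule.span_induction with
  | mem x hx =>
    obtain ⟨⟨i, j⟩, rfl⟩ := hx
    exact ⟨c ^ j, pow_ne_zero j hc, hgen i j⟩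
  | zero => exact ⟨1, one_ne_zero, by simp⟩
  | add x y _ _ hx hy =>
    obtain ⟨d, hd, hdx⟩ := hx
    obtain ⟨e, he, hey⟩ := hy
    refine ⟨d * e, mul_ne_zero hd he, ?_⟩
    rw [smul_add, mul_comm, mul_smul, mul_comm, mul_smul]
    exact W.add_mem (W.smul_mem e hdx) (W.smul_mem d hey)
  | smul a x _ hx =>
    obtain ⟨d, hd, hdx⟩ := hx
    exact ⟨d, hd, by rw [smul_comm]; exact W.smul_mem a hdx⟩
end

section
/- Let P(x) = x^d + b_{d−1}x^{d−1} + ⋯ + b_1 x + b_0 ∈ ℤ_p[x] be a monic polynomial of degree d ≥ 1 such that every root of P in a fixed algebraic closure of ℚ_p has p-adic valuation strictly greater than 0 and strictly less than 1. Then b_i ∈ pℤ_p for 0 ≤ i ≤ d−1, and p·b_0 divides p^i·b_i in ℤ_p for 1 ≤ i ≤ d. -/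
open Polynomial

/-- The strong triangle inequality for a difference. -/
theorem IsUltrametricDist.norm_sub_le_max_norm {S : Type*} [SeminormedAddCommGroup S]
    [IsUltrametricDist S] (x y : S) : ‖x - y‖ ≤ max ‖x‖ ‖y‖ := by
  simpa [sub_eq_add_neg] using IsUltrametricDist.norm_add_le_max x (-y)

/-- If every element of a multiset has norm less than one, then so do the non-leading
coefficients of the monic polynomial with these roots, and all its coefficients have norm at
most one. -/
theorem norm_coeff_prod_X_sub_C_lt_one {K : Type*} [NormedField K] [IsUltrametricDist K]
    (s : Multiset K) (hs : ∀ a ∈ s, ‖a‖ < 1) :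
    (∀ i, ‖((s.map fun a => X - C a).prod).coeff i‖ ≤ 1) ∧
      ∀ i < Multiset.card s, ‖((s.map fun a => X - C a).prod).coeff i‖ < 1 := by
  induction s using Multiset.induction_on with
  | empty =>
    refine ⟨fun i => ?_, by simp⟩
    rw [Multiset.map_zero, Multiset.prod_zero, coeff_one]
    split_ifs <;> simp
  | cons a s ih =>
    obtain ⟨hle, hlt⟩ := ih fun b hb => hs b (Multiset.mem_cons_of_mem hb)
    have ha := hs a (Multiset.mem_cons_self a s)
    rw [Multiset.map_cons, Multiset.prod_cons, Multiset.card_cons]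
    set Q := (s.map fun a => X - C a).prod
    have hmul (i : ℕ) : ‖a * Q.coeff i‖ < 1 := by
      rw [norm_mul]
      exact mul_lt_one_of_nonneg_of_lt_one_left (norm_nonneg _) ha (hle i)
    constructor
    · rintro (_ | i)
      · simpa [sub_mul] using (hmul 0).le
      · rw [sub_mul, coeff_sub, coeff_X_mul, coeff_C_mul]
        exact (IsUltrametricDist.norm_sub_le_max_norm _ _).trans (max_le (hle i) (hmul _).le)
    · rintro (_ | i) hi
      · simpa [sub_mul] using hmul 0
      · rw [sub_mul, coeff_sub, coeff_X_mul, coeff_C_mul]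
        exact (IsUltrametricDist.norm_sub_le_max_norm _ _).trans_lt
          (max_lt (hlt i (by omega)) (hmul _))

/-- If every element of a multiset has norm greater than `r`, then the coefficients `b i` of the
monic polynomial with these roots satisfy `r ^ i * ‖b i‖ < ‖b 0‖` for `i` positive. -/
theorem pow_mul_norm_coeff_prod_X_sub_C_lt {K : Type*} [NormedField K] [IsUltrametricDist K]
    {r : ℝ} (hr : 0 ≤ r) (s : Multiset K) (hs : ∀ a ∈ s, r < ‖a‖) :
    ∀ i, 1 ≤ i → r ^ i * ‖((s.map fun a => X - C a).prod).coeff i‖ <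
      ‖((s.map fun a => X - C a).prod).coeff 0‖ := by
  induction s using Multiset.induction_on with
  | empty =>
    intro i hi
    simp [coeff_one, Nat.one_le_iff_ne_zero.mp hi]
  | cons a s ih =>
    replace ih := ih fun b hb => hs b (Multiset.mem_cons_of_mem hb)
    have ha := hs a (Multiset.mem_cons_self a s)
    rw [Multiset.map_cons, Multiset.prod_cons]
    set Q := (s.map fun a => X - C a).prod
    have hpos : 0 < ‖Q.coeff 0‖ :=
      (mul_nonneg (pow_nonneg hr 1) (norm_nonneg _)).trans_lt (ih 1 le_rfl)
    have hle (i : ℕ) : r ^ i * ‖Q.coeff i‖ ≤ ‖Q.coeff 0‖ := by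
      rcases Nat.eq_zero_or_pos i with rfl | hi
      · simp
      · exact (ih i hi).le
    rintro (_ | i) hi
    · omega
    · have h0 : ‖((X - C a) * Q).coeff 0‖ = ‖a‖ * ‖Q.coeff 0‖ := by simp [sub_mul]
      rw [h0, sub_mul, coeff_sub, coeff_X_mul, coeff_C_mul]
      refine (mul_le_mul_of_nonneg_left (IsUltrametricDist.norm_sub_le_max_norm _ _)
        (pow_nonneg hr _)).trans_lt ?_
      rw [mul_max_of_nonneg _ _ (pow_nonneg hr _)]
      refine max_lt ?_ ?_
      · calc r ^ (i + 1) * ‖Q.coeff i‖ = r * (r ^ i * ‖Q.coeff i‖) := by ring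
          _ ≤ r * ‖Q.coeff 0‖ := mul_le_mul_of_nonneg_left (hle i) hr
          _ < ‖a‖ * ‖Q.coeff 0‖ := mul_lt_mul_of_pos_right ha hpos
      · calc r ^ (i + 1) * ‖a * Q.coeff (i + 1)‖
            = ‖a‖ * (r ^ (i + 1) * ‖Q.coeff (i + 1)‖) := by rw [norm_mul]; ring
          _ < ‖a‖ * ‖Q.coeff 0‖ := mul_lt_mul_of_pos_left (ih _ hi) (hr.trans_lt ha)

/-- In `ℤ_[p]`, an element of norm less than that of `y` is divisible by `p * y`. -/
theorem PadicInt.p_mul_dvd_of_norm_lt {p : ℕ} [Fact p.Prime] {x y : ℤ_[p]} (h : ‖x‖ < ‖y‖) :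
    (p : ℤ_[p]) * y ∣ x := by
  have hy : 0 < ‖y‖ := (norm_nonneg x).trans_lt h
  have hy' : (y : ℚ_[p]) ≠ 0 := by
    rw [← norm_pos_iff]
    simpa using hy
  have hq : ‖(x : ℚ_[p]) / y‖ < 1 := by
    rw [norm_div, div_lt_one (by simpa using hy)]
    simpa using h
  let c : ℤ_[p] := ⟨(x : ℚ_[p]) / y, hq.le⟩
  have hx : x = c * y := by
    apply Subtype.ext
    rw [PadicInt.coe_mul]
    exact (div_mul_cancel₀ _ hy').symm
  rw [hx]
  exact mul_dvd_mul_right (PadicInt.norm_lt_one_iff_dvd c |>.mp hq) y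

/-- If `P ∈ ℤ_p[x]` is monic of degree `d ≥ 1` and all roots of `P` have
p-adic valuation strictly between `0` and `1` (i.e. `p⁻¹ < ‖α‖ < 1`), then the coefficients
satisfy `b_i ∈ pℤ_p` for `0 ≤ i ≤ d−1`, and `p·b_0 ∣ p^i·b_i` in `ℤ_p` for `1 ≤ i ≤ d`. -/
theorem coefficients_of_nonordinary_polynomial
    {p : ℕ} [Fact p.Prime]
    -- `K` is a fixed algebraic closure of `ℚ_p` with the unique extension of the p-adic norm
    {K : Type} [NormedField K] [Algebra ℚ_[p] K] [IsAlgClosure ℚ_[p] K]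
    (hnorm : ∀ x : ℚ_[p], ‖algebraMap ℚ_[p] K x‖ = ‖x‖)
    (d : ℕ) (hd : 1 ≤ d)
    (P : ℤ_[p][X]) (hmonic : P.Monic) (hdeg : P.natDegree = d)
    (hroots : ∀ α : K, Polynomial.aeval α (P.map (algebraMap ℤ_[p] ℚ_[p])) = 0 →
      (p : ℝ)⁻¹ < ‖α‖ ∧ ‖α‖ < 1) :
    (∀ i < d, (p : ℤ_[p]) ∣ P.coeff i) ∧
    (∀ i, 1 ≤ i → i ≤ d → ((p : ℤ_[p]) * P.coeff 0) ∣ ((p : ℤ_[p]) ^ i * P.coeff i)) := by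
  have : IsUltrametricDist K := IsUltrametricDist.isUltrametricDist_of_forall_norm_natCast_le_one
    fun n => by
      rw [← map_natCast (algebraMap ℚ_[p] K), hnorm]
      exact IsUltrametricDist.norm_natCast_le_one ℚ_[p] n
  have : IsAlgClosed K := IsAlgClosure.isAlgClosed ℚ_[p]
  set R := P.map (algebraMap ℤ_[p] ℚ_[p]) with hR
  set Q := R.map (algebraMap ℚ_[p] K) with hQ
  have hQmonic : Q.Monic := (hmonic.map _).map _
  have hQdeg : Q.natDegree = d := by
    rw [hQ, (hmonic.map _).natDegree_map, hmonic.natDegree_map, hdeg]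
  have hsplits : Q.Splits := IsAlgClosed.splits Q
  have hprod : (Q.roots.map fun a => X - C a).prod = Q :=
    (hsplits.eq_prod_roots_of_monic hQmonic).symm
  have hcard : Multiset.card Q.roots = d := by
    rw [← hsplits.natDegree_eq_card_roots, hQdeg]
  have hcoeff (i : ℕ) : ‖Q.coeff i‖ = ‖P.coeff i‖ := by
    rw [hQ, coeff_map, hnorm, hR, coeff_map]
    rfl
  have hbound (a : K) (ha : a ∈ Q.roots) : (p : ℝ)⁻¹ < ‖a‖ ∧ ‖a‖ < 1 := by
    refine hroots a ?_
    rw [aeval_def, ← eval_map]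
    exact isRoot_of_mem_roots ha
  constructor
  · intro i hi
    rw [← PadicInt.norm_lt_one_iff_dvd, ← hcoeff, ← hprod]
    exact (norm_coeff_prod_X_sub_C_lt_one _ fun a ha => (hbound a ha).2).2 i (hcard.symm ▸ hi)
  · intro i hi _
    apply PadicInt.p_mul_dvd_of_norm_lt
    have h := pow_mul_norm_coeff_prod_X_sub_C_lt (by positivity) Q.roots
      (fun a ha => (hbound a ha).1) i hi
    rw [hprod, hcoeff, hcoeff] at h
    rwa [norm_mul, norm_pow, PadicInt.norm_p]
end

section
/- Let c be an element of the fixed algebraic closure of ℚ_p with ‖c‖ < 1. Then every root x of f(X) − c in the algebraic closure satisfies ‖x‖ < 1. Consequently, if π_0 = 0 and f(π_n) = π_{n−1} for all n ≥ 1, then ‖π_n‖ < 1 for every n ≥ 0. -/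
open Polynomial

theorem norm_lt_one_of_norm_aeval_lt_one_s12 {F K : Type*} [NormedField F] [NormedField K]
    [IsUltrametricDist K] [NormedAlgebra F K] {n : ℕ} (hn : 1 ≤ n) (α : ℕ → F)
    (hα : ∀ i, 1 ≤ i → i ≤ n - 1 → ‖α i‖ < 1) {x : K}
    (hx : ‖aeval x (X ^ n + ∑ i ∈ Finset.Icc 1 (n - 1), C (α i) * X ^ i)‖ < 1) :
    ‖x‖ < 1 := by
  by_contra! hx1
  have hsum : ‖∑ i ∈ Finset.Icc 1 (n - 1), algebraMap F K (α i) * x ^ i‖ < ‖x ^ n‖ := by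
    obtain hs | hs := (Finset.Icc 1 (n - 1)).eq_empty_or_nonempty
    · simp only [hs, Finset.sum_empty, norm_zero, norm_pow]
      positivity
    obtain ⟨i, hi, hle⟩ := IsUltrametricDist.exists_norm_finsetSum_le_of_nonempty hs
      fun i ↦ algebraMap F K (α i) * x ^ i
    obtain ⟨hi1, hin⟩ := Finset.mem_Icc.mp hi
    refine hle.trans_lt ?_
    rw [norm_mul, norm_algebraMap', norm_pow, norm_pow]
    calc ‖α i‖ * ‖x‖ ^ i < 1 * ‖x‖ ^ i := by gcongr; exact hα i hi1 hin
      _ ≤ ‖x‖ ^ n := by rw [one_mul]; exact pow_le_pow_right₀ hx1 (by lia)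
  simp only [map_add, map_sum, map_mul, map_pow, aeval_X, aeval_C] at hx
  rw [IsUltrametricDist.norm_add_eq_max_of_norm_ne_norm hsum.ne', max_eq_left hsum.le,
    norm_pow] at hx
  exact (one_le_pow₀ hx1).not_gt hx

/-- If `‖c‖ < 1` then every root of `f(X) − c` has norm `< 1`; consequently
all the elements `π_n` of the tower (`π_0 = 0`, `f(π_n) = π_{n−1}`) have norm `< 1`. -/
theorem roots_of_f_sub_small_are_small
    {p : ℕ} [Fact p.Prime]
    -- `K` is a fixed algebraic closure of `ℚ_p` with the unique extension of the p-adic norm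
    {K : Type} [NormedField K] [Algebra ℚ_[p] K] [IsAlgClosure ℚ_[p] K]
    (hnorm : ∀ x : ℚ_[p], ‖algebraMap ℚ_[p] K x‖ = ‖x‖)
    -- the polynomial f(X) = X^p + α_{p-1} X^{p-1} + ⋯ + α_1 X, with α_i ∈ pℤ_p, v_p(α_1) = 1
    (α : ℕ → ℚ_[p])
    (hα : ∀ i, 1 ≤ i → i ≤ p - 1 → ‖α i‖ ≤ (p : ℝ)⁻¹)
    (hα1 : ‖α 1‖ = (p : ℝ)⁻¹)
    (f : ℚ_[p][X])
    (hf : f = X ^ p + ∑ i ∈ Finset.Icc 1 (p - 1), C (α i) * X ^ i) :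
    (∀ c : K, ‖c‖ < 1 → ∀ x : K, Polynomial.aeval x f = c → ‖x‖ < 1) ∧
    (∀ π : ℕ → K, π 0 = 0 → (∀ n : ℕ, Polynomial.aeval (π (n + 1)) f = π n) →
      ∀ n : ℕ, ‖π n‖ < 1) := by
  let : NormedAlgebra ℚ_[p] K :=
    { norm_smul_le := fun a x ↦ by rw [Algebra.smul_def, norm_mul, hnorm] }
  have : IsUltrametricDist K := IsUltrametricDist.of_normedAlgebra ℚ_[p]
  have hp : 1 < p := (Fact.out : p.Prime).one_lt
  have root_norm_lt (x : K) (hx : ‖aeval x f‖ < 1) : ‖x‖ < 1 := by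
    subst hf
    exact norm_lt_one_of_norm_aeval_lt_one_s12 hp.le α
      (fun i h1 hi ↦ (hα i h1 hi).trans_lt (inv_lt_one_of_one_lt₀ (by exact_mod_cast hp))) hx
  refine ⟨fun c hc x hx ↦ root_norm_lt x (hx ▸ hc), fun π h0 hπ n ↦ ?_⟩
  induction n with
  | zero => simp [h0]
  | succ n ih => exact root_norm_lt _ (by rwa [hπ n])
end
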